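/- arXiv:math/9810158 — 5 statements merged into one kernel-verified Lean document; each statement's English description precedes it below -/
import Mathlib

section
/- (Lemma 3.1.) For every integer i ≥ 0 and every polynomial g ∈ ℝ[x,p], one has x^i *_λ g = g *_λ x^i + Σ_{k=1}^{i} C(i,k) (2λ)^k (∂_p^k g) *_λ x^{i−k}. -/
/- The Moyal product on ℝ[x,p], where x = X 0 and p = X 1 in `MvPolynomial (Fin 2) ℝ`:
   f *_λ g := Σ_{i=0}^∞ (λ^i/i!) Σ_{k=0}^i C(i,k) (−1)^k (∂_x^{i−k}∂_p^k f)·(∂_x^k ∂_p^{i−k} g).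
   On polynomials only finitely many terms are nonzero, so the `finsum` below is faithful. -/

open MvPolynomial

/-- Differentiation with respect to x (the variable `X 0`). -/
noncomputable def dX : MvPolynomial (Fin 2) ℝ → MvPolynomial (Fin 2) ℝ :=
  fun f => pderiv (0 : Fin 2) f

/-- Differentiation with respect to p (the variable `X 1`). -/
noncomputable def dP : MvPolynomial (Fin 2) ℝ → MvPolynomial (Fin 2) ℝ :=
  fun f => pderiv (1 : Fin 2) f

/-- The Moyal star product with deformation parameter `lam`. -/
noncomputable def moyal (lam : ℝ) (f g : MvPolynomial (Fin 2) ℝ) : MvPolynomial (Fin 2) ℝ :=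
  ∑ᶠ i : ℕ, (lam ^ i / (i.factorial : ℝ)) •
    ∑ k ∈ Finset.range (i + 1),
      ((i.choose k : ℝ) * (-1 : ℝ) ^ k) • (dX^[i - k] (dP^[k] f) * dX^[k] (dP^[i - k] g))

/-- The inclusion of polynomials in the single variable p into ℝ[x,p]. -/
noncomputable def toMv (q : Polynomial ℝ) : MvPolynomial (Fin 2) ℝ :=
  Polynomial.aeval (X 1 : MvPolynomial (Fin 2) ℝ) q

/-- The operator `g ↦ x g + c ∂_p g`. -/
noncomputable def mulXAddPderiv (c : ℝ) : Module.End ℝ (MvPolynomial (Fin 2) ℝ) :=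
  LinearMap.mulLeft ℝ (X 0) + c • (pderiv (1 : Fin 2)).toLinearMap

theorem dX_iterate_zero (n : ℕ) : dX^[n] 0 = 0 :=
  Function.iterate_fixed (map_zero (pderiv 0)) n

theorem dP_iterate_X_zero_pow (i : ℕ) {k : ℕ} (hk : k ≠ 0) :
    dP^[k] (X 0 ^ i : MvPolynomial (Fin 2) ℝ) = 0 := by
  obtain ⟨k, rfl⟩ := Nat.exists_eq_succ_of_ne_zero hk
  have h : dP (X 0 ^ i : MvPolynomial (Fin 2) ℝ) = 0 := by
    simp [dP, Derivation.leibniz_pow]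
  rw [Function.iterate_succ_apply, h]
  exact Function.iterate_fixed (map_zero (pderiv 1)) k

theorem dX_iterate_X_zero_pow (i m : ℕ) :
    dX^[m] (X 0 ^ i : MvPolynomial (Fin 2) ℝ) = (i.descFactorial m : ℝ) • X 0 ^ (i - m) := by
  induction m with
  | zero => simp
  | succ m ih =>
    rw [Function.iterate_succ_apply', ih]
    simp [dX, Derivation.leibniz_pow, Nat.descFactorial_succ, Nat.sub_sub, smul_eq_C_mul]
    ring

theorem dP_iterate_eq_pow (m : ℕ) (g : MvPolynomial (Fin 2) ℝ) :
    dP^[m] g = ((pderiv (1 : Fin 2)).toLinearMap ^ m : Module.End ℝ (MvPolynomial (Fin 2) ℝ)) g :=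
  (Module.End.pow_apply _ m g).symm

theorem commute_mulLeft_X_zero_pderiv_one :
    Commute (LinearMap.mulLeft ℝ (X 0 : MvPolynomial (Fin 2) ℝ))
      (pderiv (1 : Fin 2)).toLinearMap := by
  refine LinearMap.ext fun g => ?_
  simp

theorem mulXAddPderiv_pow_apply (c : ℝ) (i : ℕ) (g : MvPolynomial (Fin 2) ℝ) :
    (mulXAddPderiv c ^ i) g =
      ∑ m ∈ Finset.range (i + 1), ((i.choose m : ℝ) * c ^ m) • (X 0 ^ (i - m) * dP^[m] g) := by
  rw [mulXAddPderiv, add_comm, (commute_mulLeft_X_zero_pderiv_one.symm.smul_left c).add_pow,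
    LinearMap.sum_apply]
  refine Finset.sum_congr rfl fun m _ => ?_
  rw [← ((commute_mulLeft_X_zero_pderiv_one.smul_right c).pow_pow (i - m) m).eq,
    ← nsmul_eq_mul', smul_pow, dP_iterate_eq_pow, LinearMap.pow_mulLeft]
  simp only [LinearMap.smul_apply, Module.End.mul_apply, LinearMap.mulLeft_apply, mul_smul_comm,
    mul_smul, Nat.cast_smul_eq_nsmul]

theorem finsum_descFactorial_eq (lam c : ℝ) (i : ℕ) (g : MvPolynomial (Fin 2) ℝ) :
    ∑ᶠ m : ℕ, (lam ^ m / (m.factorial : ℝ)) •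
        (c ^ m * i.descFactorial m : ℝ) • ((X 0 : MvPolynomial (Fin 2) ℝ) ^ (i - m) * dP^[m] g) =
      (mulXAddPderiv (c * lam) ^ i) g := by
  rw [mulXAddPderiv_pow_apply, finsum_eq_sum_of_support_subset (s := Finset.range (i + 1))]
  · refine Finset.sum_congr rfl fun m _ => ?_
    rw [smul_smul, Nat.descFactorial_eq_factorial_mul_choose]
    congr 1
    have := Nat.cast_ne_zero (R := ℝ).mpr m.factorial_ne_zero
    rw [mul_pow]
    push_cast
    field_simp
  · intro m hm
    by_contra hmi
    simp only [Finset.coe_range, Set.mem_Iio, not_lt] at hmi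
    exact hm (by simp [Nat.descFactorial_of_lt (Nat.lt_of_succ_le hmi)])

theorem moyal_X_zero_pow_left (lam : ℝ) (i : ℕ) (g : MvPolynomial (Fin 2) ℝ) :
    moyal lam (X 0 ^ i) g =
      (mulXAddPderiv lam ^ i) g := by
  have h := finsum_descFactorial_eq lam 1 i g
  rw [one_mul] at h
  rw [← h, moyal]
  refine finsum_congr fun m => ?_
  rw [Finset.sum_eq_single 0]
  · simp [dX_iterate_X_zero_pow]
  · intro k _ hk
    simp [dP_iterate_X_zero_pow i hk, dX_iterate_zero]
  · simp

theorem moyal_X_zero_pow_right (lam : ℝ) (i : ℕ) (g : MvPolynomial (Fin 2) ℝ) :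
    moyal lam g (X 0 ^ i) =
      (mulXAddPderiv (-lam) ^ i) g := by
  have h := finsum_descFactorial_eq lam (-1) i g
  rw [neg_one_mul] at h
  rw [← h, moyal]
  refine finsum_congr fun m => ?_
  rw [Finset.sum_eq_single m]
  · simp [dX_iterate_X_zero_pow, mul_smul, mul_comm, smul_comm ((-1 : ℝ) ^ m)]
  · intro k hk hkm
    have : m - k ≠ 0 := by grind
    simp [dP_iterate_X_zero_pow i this, dX_iterate_zero]
  · simp

/-- Lemma 3.1: for every i ≥ 0 and every g ∈ ℝ[x,p],
x^i *_λ g = g *_λ x^i + Σ_{k=1}^{i} C(i,k) (2λ)^k (∂_p^k g) *_λ x^{i−k}. -/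
theorem lemma_3_1 (lam : ℝ) (i : ℕ) (g : MvPolynomial (Fin 2) ℝ) :
    moyal lam (X 0 ^ i) g =
      moyal lam g (X 0 ^ i) +
        ∑ k ∈ Finset.Icc 1 i,
          ((i.choose k : ℝ) * (2 * lam) ^ k) • moyal lam (dP^[k] g) (X 0 ^ (i - k)) := by
  set A := LinearMap.mulLeft ℝ (X 0 : MvPolynomial (Fin 2) ℝ)
  set D : Module.End ℝ (MvPolynomial (Fin 2) ℝ) := (pderiv (1 : Fin 2)).toLinearMap
  have hcomm : Commute (A + (-lam) • D) ((2 * lam) • D) :=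
    (commute_mulLeft_X_zero_pderiv_one.add_left
      ((Commute.refl D).smul_left (-lam))).smul_right (2 * lam)
  have hsplit : mulXAddPderiv lam = (2 * lam) • D + (A + (-lam) • D) := by
    rw [mulXAddPderiv]
    module
  rw [moyal_X_zero_pow_left, hsplit, hcomm.symm.add_pow, LinearMap.sum_apply,
    Finset.range_eq_Ico, Finset.sum_eq_sum_Ico_succ_bot (Nat.succ_pos i)]
  congr 1
  · simp [moyal_X_zero_pow_right, mulXAddPderiv, A, D]
  · refine Finset.sum_congr rfl fun k _ => ?_
    rw [← (hcomm.pow_pow (i - k) k).eq, ← nsmul_eq_mul', smul_pow, moyal_X_zero_pow_right,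
      dP_iterate_eq_pow]
    simp only [LinearMap.smul_apply, Module.End.mul_apply, map_smul, mul_smul,
      Nat.cast_smul_eq_nsmul, mulXAddPderiv, A, D]
end

section
/- Every element of ℝ[x,p] has a unique canonical representative modulo the left ideal generated by x^n: for every f ∈ ℝ[x,p] there exist unique polynomials h₀,…,h_{n−1} ∈ ℝ[p] in the variable p alone such that f − Σ_{i=0}^{n−1} h_i *_λ x^i ∈ J_l, where J_l := {g *_λ x^n : g ∈ ℝ[x,p]}. -/
/- The Moyal product on ℝ[x,p], where x = X 0 and p = X 1 in `MvPolynomial (Fin 2) ℝ`: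
   f *_λ g := Σ_{i=0}^∞ (λ^i/i!) Σ_{k=0}^i C(i,k) (−1)^k (∂_x^{i−k}∂_p^k f)·(∂_x^k ∂_p^{i−k} g).
   On polynomials only finitely many terms are nonzero, so the `finsum` below is faithful. -/

open MvPolynomial

/-- The left ideal J_l = ℝ[x,p] *_λ x^n. -/
def Jl (lam : ℝ) (n : ℕ) : Set (MvPolynomial (Fin 2) ℝ) :=
  {f | ∃ g : MvPolynomial (Fin 2) ℝ, f = moyal lam g (X 0 ^ n)}

/-- If `T` is a linear endomorphism and every vector decomposes as `ι h + T g`, then every vector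
decomposes as `∑ i < n, T ^ i (ι (h i)) + T ^ n g`. -/
lemma exists_sum_pow_apply_add {V H : Type*} [AddCommGroup V] [Module ℝ V] [AddCommGroup H]
    (T : Module.End ℝ V) (ι : H →+ V) (hex : ∀ f, ∃ h g, f = ι h + T g) (n : ℕ) (f : V) :
    ∃ (h : Fin n → H) (g : V), f = ∑ i : Fin n, (T ^ (i : ℕ)) (ι (h i)) + (T ^ n) g := by
  induction n with
  | zero => exact ⟨Fin.elim0, f, by simp⟩
  | succ n ih =>
    obtain ⟨h, g, hf⟩ := ih
    obtain ⟨a, g', hg⟩ := hex g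
    refine ⟨Fin.snoc h a, g', ?_⟩
    rw [hf, hg, Fin.sum_univ_castSucc, pow_succ]
    simp [add_assoc]

/-- If `ι h + T g = 0` forces `h = 0` and `g = 0`, then the coefficients in the decomposition
`∑ i < n, T ^ i (ι (h i)) + T ^ n g` are unique. -/
lemma eq_zero_of_sum_pow_apply_add {V H : Type*} [AddCommGroup V] [Module ℝ V] [AddCommGroup H]
    (T : Module.End ℝ V) (ι : H →+ V) (huniq : ∀ h g, ι h + T g = 0 → h = 0 ∧ g = 0) (n : ℕ)
    (h : Fin n → H) (g : V) (hz : ∑ i : Fin n, (T ^ (i : ℕ)) (ι (h i)) + (T ^ n) g = 0) :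
    h = 0 := by
  have key : (∀ i, h i = 0) := by
    induction n with
    | zero => exact fun i => i.elim0
    | succ n ih =>
      rw [Fin.sum_univ_succ, pow_succ'] at hz
      simp only [Fin.val_zero, pow_zero, Module.End.one_apply, Fin.val_succ, pow_succ',
        Module.End.mul_apply, ← map_sum, add_assoc, ← map_add T] at hz
      obtain ⟨h0, hr⟩ := huniq _ _ hz
      exact Fin.cases h0 (ih (fun i => h i.succ) hr)
  exact funext key

/-- The operator `g ↦ x g - λ ∂ₚ g` of right Moyal multiplication by `x`. -/
noncomputable def moyalX (lam : ℝ) : Module.End ℝ (MvPolynomial (Fin 2) ℝ) :=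
  (-lam) • (pderiv (1 : Fin 2)).toLinearMap + LinearMap.mulLeft ℝ (X 0)

lemma moyalX_apply (lam : ℝ) (g : MvPolynomial (Fin 2) ℝ) :
    moyalX lam g = X 0 * g - lam • pderiv 1 g := by
  simp [moyalX]
  ring

lemma iterate_dX_X_pow (n i : ℕ) :
    dX^[i] (X 0 ^ n) = (n.descFactorial i : MvPolynomial (Fin 2) ℝ) * X 0 ^ (n - i) := by
  induction i with
  | zero => simp
  | succ i ih =>
    rw [Function.iterate_succ_apply', ih]
    simp only [dX, Derivation.leibniz, Derivation.leibniz_pow, Derivation.map_natCast, pderiv_X_self,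
      Nat.descFactorial_succ, smul_eq_mul, nsmul_eq_mul, mul_one, mul_zero, add_zero, Nat.cast_mul,
      Nat.sub_sub]
    ring

lemma iterate_dX_zero (i : ℕ) : dX^[i] 0 = 0 :=
  Function.iterate_fixed (by simp [dX]) i

lemma iterate_dP_X_pow {i : ℕ} (hi : i ≠ 0) (n : ℕ) : dP^[i] (X 0 ^ n) = 0 := by
  obtain ⟨j, rfl⟩ := Nat.exists_eq_succ_of_ne_zero hi
  rw [Function.iterate_succ_apply]
  have : dP (X 0 ^ n) = 0 := by simp [dP, Derivation.leibniz_pow, pderiv_X]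
  rw [this]
  exact Function.iterate_fixed (by simp [dP]) j

lemma iterate_dP_eq_pow (i : ℕ) (g : MvPolynomial (Fin 2) ℝ) :
    dP^[i] g = ((pderiv (1 : Fin 2)).toLinearMap ^ i : Module.End ℝ (MvPolynomial (Fin 2) ℝ)) g := by
  rw [Module.End.pow_apply]
  rfl

/-- Right Moyal multiplication by `x ^ n` is the `n`-th power of `g ↦ x g - λ ∂ₚ g`. -/
lemma moyal_X_pow (lam : ℝ) (g : MvPolynomial (Fin 2) ℝ) (n : ℕ) :
    moyal lam g (X 0 ^ n) = (moyalX lam ^ n) g := by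
  have hterm : ∀ i : ℕ, (lam ^ i / (i.factorial : ℝ)) •
      ∑ k ∈ Finset.range (i + 1), ((i.choose k : ℝ) * (-1 : ℝ) ^ k) •
        (dX^[i - k] (dP^[k] g) * dX^[k] (dP^[i - k] (X 0 ^ n))) =
      (n.choose i : ℝ) • ((-lam) ^ i • (X 0 ^ (n - i) * dP^[i] g)) := by
    intro i
    rw [Finset.sum_eq_single_of_mem i (by simp)]
    · rw [Nat.sub_self, Function.iterate_zero_apply, Function.iterate_zero_apply,
        iterate_dX_X_pow, Nat.descFactorial_eq_factorial_mul_choose, Nat.choose_self,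
        neg_pow lam, ← map_natCast (C : ℝ →+* MvPolynomial (Fin 2) ℝ),
        mul_left_comm, ← MvPolynomial.smul_eq_C_mul, smul_smul, smul_smul, smul_smul,
        mul_comm (dP^[i] g)]
      congr 1
      push_cast
      field_simp
    · intro k hk hki
      rw [iterate_dP_X_pow (by simp at hk; omega), iterate_dX_zero, mul_zero, smul_zero]
  have hcomm : Commute ((-lam) • (pderiv (1 : Fin 2)).toLinearMap :
      Module.End ℝ (MvPolynomial (Fin 2) ℝ)) (LinearMap.mulLeft ℝ (X 0)) := by
    refine Commute.smul_left (LinearMap.ext fun f => ?_) _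
    simp [Derivation.leibniz, pderiv_X]
  rw [moyal, finsum_congr hterm, finsum_eq_sum_of_support_subset (s := Finset.range (n + 1)),
    moyalX, hcomm.add_pow, LinearMap.sum_apply]
  · refine Finset.sum_congr rfl fun i _ => ?_
    rw [(hcomm.pow_pow _ _).eq, (Nat.cast_commute (n.choose i) _).eq.symm, smul_pow,
      LinearMap.pow_mulLeft, iterate_dP_eq_pow]
    simp [Nat.cast_smul_eq_nsmul]
  · intro i hi
    by_contra hin
    refine hi ?_
    simp only [Finset.coe_range, Set.mem_Iio, not_lt] at hin
    simp [Nat.choose_eq_zero_of_lt (show n < i by omega)]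

lemma toMv_coeff_eq_zero (q : Polynomial ℝ) (m : Fin 2 →₀ ℕ) (hm : m 0 ≠ 0) :
    (toMv q).coeff m = 0 := by
  induction q using Polynomial.induction_on' with
  | add p q hp hq => simp_all [toMv]
  | monomial k a =>
    rw [toMv, Polynomial.aeval_monomial, MvPolynomial.algebraMap_eq, coeff_C_mul, coeff_X_pow,
      if_neg, mul_zero]
    rintro rfl
    simp at hm

lemma toMv_injective : Function.Injective toMv :=
  (algebraicIndependent_X (Fin 2) ℝ).transcendental 1 |> transcendental_iff_injective.1

/-- Every polynomial is the sum of a polynomial in `p` and a right Moyal multiple of `x`. -/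
lemma exists_toMv_add_moyalX (lam : ℝ) (f : MvPolynomial (Fin 2) ℝ) :
    ∃ h g, f = toMv h + moyalX lam g := by
  have hmon : ∀ (k : ℕ) (q : Polynomial ℝ), ∃ h g, X 0 ^ k * toMv q = toMv h + moyalX lam g := by
    intro k
    induction k with
    | zero => exact fun q => ⟨q, 0, by simp⟩
    | succ k ih =>
      intro q
      obtain ⟨h, g, hg⟩ := ih (lam • Polynomial.derivative q)
      refine ⟨h, X 0 ^ k * toMv q + g, ?_⟩
      have hder : pderiv 1 (toMv q) = toMv (Polynomial.derivative q) := by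
        rw [toMv, Derivation.map_aeval, pderiv_X_self, smul_eq_mul, mul_one, toMv]
      have hsmul : toMv (lam • Polynomial.derivative q) = lam • toMv (Polynomial.derivative q) :=
        map_smul (Polynomial.aeval _) _ _
      rw [map_add, add_left_comm, ← hg, hsmul, moyalX_apply, Derivation.leibniz, hder,
        Derivation.leibniz_pow, pderiv_X_of_ne (by decide)]
      simp only [smul_eq_mul, mul_zero, smul_zero, add_zero, mul_smul_comm]
      ring
  induction f using MvPolynomial.induction_on' with
  | monomial u a =>
    obtain ⟨h, g, hg⟩ := hmon (u 0) (Polynomial.monomial (u 1) a)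
    refine ⟨h, g, hg ▸ ?_⟩
    rw [toMv, Polynomial.aeval_monomial, MvPolynomial.algebraMap_eq, monomial_eq,
      Finsupp.prod_fintype _ _ (by simp), Fin.prod_univ_two]
    ring
  | add f₁ f₂ h₁ h₂ =>
    obtain ⟨a, b, rfl⟩ := h₁
    obtain ⟨c, d, rfl⟩ := h₂
    exact ⟨a + c, b + d, by simp only [toMv, map_add]; ring⟩

/-- The decomposition of a polynomial into a polynomial in `p` and a right Moyal multiple of `x`
is unique. -/
lemma eq_zero_of_toMv_add_moyalX (lam : ℝ) (h : Polynomial ℝ) (g : MvPolynomial (Fin 2) ℝ)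
    (hz : toMv h + moyalX lam g = 0) : h = 0 ∧ g = 0 := by
  have hrec : ∀ m : Fin 2 →₀ ℕ, coeff m g =
      lam * (coeff (Finsupp.single 0 1 + m + Finsupp.single 1 1) g * (m 1 + 1)) := by
    intro m
    have := congrArg (coeff (Finsupp.single 0 1 + m)) hz
    rw [moyalX_apply, coeff_add, coeff_sub, toMv_coeff_eq_zero _ _ (by simp), coeff_X_mul,
      coeff_smul, coeff_pderiv] at this
    simp at this
    linarith
  have hvan : ∀ (k : ℕ) (m : Fin 2 →₀ ℕ), g.totalDegree < m.degree + k → coeff m g = 0 := by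
    intro k
    induction k with
    | zero => exact fun m hm => coeff_eq_zero_of_totalDegree_lt (by simpa [Finsupp.degree_apply] using hm)
    | succ k ih =>
      intro m hm
      rw [hrec, ih _ (by simp [map_add]; omega), zero_mul, mul_zero]
  have hg : g = 0 := MvPolynomial.ext _ _ fun m =>
    (hvan (g.totalDegree + 1) m (by omega)).trans (coeff_zero m).symm
  refine ⟨toMv_injective ?_, hg⟩
  rw [hg, map_zero, add_zero] at hz
  simpa [toMv] using hz

/-- every f ∈ ℝ[x,p] has a unique canonical representative modulo J_l:
there exist unique polynomials h₀,…,h_{n−1} ∈ ℝ[p] in p alone such that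
f − Σ_{i=0}^{n−1} h_i *_λ x^i ∈ J_l. -/
theorem canonical_representative (lam : ℝ) (n : ℕ) (hn : 1 ≤ n)
    (f : MvPolynomial (Fin 2) ℝ) :
    ∃! h : Fin n → Polynomial ℝ,
      f - ∑ i : Fin n, moyal lam (toMv (h i)) (X 0 ^ (i : ℕ)) ∈ Jl lam n := by
  let ι : Polynomial ℝ →+ MvPolynomial (Fin 2) ℝ :=
    (Polynomial.aeval (X 1 : MvPolynomial (Fin 2) ℝ)).toRingHom.toAddMonoidHom
  have hι : ∀ q, toMv q = ι q := fun _ => rfl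
  simp only [Jl, Set.mem_ofPred_eq, moyal_X_pow, hι]
  obtain ⟨h, g, hf⟩ := exists_sum_pow_apply_add (moyalX lam) ι (exists_toMv_add_moyalX lam) n f
  refine ⟨h, ⟨g, sub_eq_iff_eq_add'.2 hf⟩, ?_⟩
  rintro h' ⟨g', hg'⟩
  refine sub_eq_zero.1 (eq_zero_of_sum_pow_apply_add (moyalX lam) ι
    (eq_zero_of_toMv_add_moyalX lam) n (h' - h) (g' - g) ?_)
  simp only [Pi.sub_apply, map_sub, Finset.sum_sub_distrib]
  rw [← hg']
  nth_rewrite 1 [hf]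
  abel
end

section
/- (Theorem 3.5.) Let J_l := {g *_λ x^n : g ∈ ℝ[x,p]} and N_l := {f ∈ ℝ[x,p] : x^n *_λ f ∈ J_l}. For every real λ ≠ 0, the quotient algebra Q := N_l/J_l, with product induced by the Moyal product *_λ, is isomorphic as an ℝ-algebra to the algebra Mat_n(ℝ) of n×n real matrices. -/
/- The Moyal product on ℝ[x,p], where x = X 0 and p = X 1 in `MvPolynomial (Fin 2) ℝ`:
   f *_λ g := Σ_{i=0}^∞ (λ^i/i!) Σ_{k=0}^i C(i,k) (−1)^k (∂_x^{i−k}∂_p^k f)·(∂_x^k ∂_p^{i−k} g).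
   On polynomials only finitely many terms are nonzero, so the `finsum` below is faithful. -/

open MvPolynomial

/-- The normalizer N_l = {f : x^n *_λ f ∈ J_l}. -/
def Nl (lam : ℝ) (n : ℕ) : Set (MvPolynomial (Fin 2) ℝ) :=
  {f | moyal lam (X 0 ^ n) f ∈ Jl lam n}

namespace Moyal

/-! ### The partial derivatives and their iterates -/

lemma dX_add (f g : MvPolynomial (Fin 2) ℝ) : dX (f + g) = dX f + dX g := map_add _ f g

lemma dP_add (f g : MvPolynomial (Fin 2) ℝ) : dP (f + g) = dP f + dP g := map_add _ f g

lemma dX_smul (c : ℝ) (f : MvPolynomial (Fin 2) ℝ) : dX (c • f) = c • dX f :=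
  Derivation.map_smul _ c f

lemma dP_smul (c : ℝ) (f : MvPolynomial (Fin 2) ℝ) : dP (c • f) = c • dP f :=
  Derivation.map_smul _ c f

lemma dX_X_zero_mul (f : MvPolynomial (Fin 2) ℝ) : dX (X 0 * f) = f + X 0 * dX f := by
  simp [dX, add_comm]

lemma dP_X_zero_mul (f : MvPolynomial (Fin 2) ℝ) : dP (X 0 * f) = X 0 * dP f := by
  simp [dP]

lemma dX_X_one_mul (f : MvPolynomial (Fin 2) ℝ) : dX (X 1 * f) = X 1 * dX f := by
  simp [dX]

lemma dP_X_one_mul (f : MvPolynomial (Fin 2) ℝ) : dP (X 1 * f) = f + X 1 * dP f := by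
  simp [dP, add_comm]

lemma dX_dP_comm : Function.Commute dX dP := by
  intro f
  ext m
  simp only [dX, dP, coeff_pderiv, Finsupp.add_apply, Finsupp.single_apply]
  rw [add_right_comm m]
  simp
  ring

lemma iterate_dX_add (k : ℕ) (f g : MvPolynomial (Fin 2) ℝ) :
    dX^[k] (f + g) = dX^[k] f + dX^[k] g := iterate_map_add (pderiv 0) k f g

lemma iterate_dP_add (k : ℕ) (f g : MvPolynomial (Fin 2) ℝ) :
    dP^[k] (f + g) = dP^[k] f + dP^[k] g := iterate_map_add (pderiv 1) k f g

lemma iterate_dX_smul (k : ℕ) (c : ℝ) (f : MvPolynomial (Fin 2) ℝ) :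
    dX^[k] (c • f) = c • dX^[k] f := by
  induction k with
  | zero => rfl
  | succ k ih => simp only [Function.iterate_succ_apply', ih, dX_smul]

lemma iterate_dX_X_zero_mul (k : ℕ) (f : MvPolynomial (Fin 2) ℝ) :
    dX^[k] (X 0 * f) = X 0 * dX^[k] f + (k : ℝ) • dX^[k - 1] f := by
  induction k with
  | zero => simp
  | succ k ih =>
    rw [Function.iterate_succ_apply', ih, dX_add, dX_X_zero_mul, dX_smul,
      Function.iterate_succ_apply' dX k]
    rcases k with _ | k
    · simp [add_comm]
    · simp only [Nat.add_sub_cancel, ← Function.iterate_succ_apply' dX]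
      push_cast
      module

lemma iterate_dP_X_one_mul (k : ℕ) (f : MvPolynomial (Fin 2) ℝ) :
    dP^[k] (X 1 * f) = X 1 * dP^[k] f + (k : ℝ) • dP^[k - 1] f := by
  induction k with
  | zero => simp
  | succ k ih =>
    rw [Function.iterate_succ_apply', ih, dP_add, dP_X_one_mul, dP_smul,
      Function.iterate_succ_apply' dP k]
    rcases k with _ | k
    · simp [add_comm]
    · simp only [Nat.add_sub_cancel, ← Function.iterate_succ_apply' dP]
      push_cast
      module

lemma iterate_dP_X_zero_mul (k : ℕ) (f : MvPolynomial (Fin 2) ℝ) :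
    dP^[k] (X 0 * f) = X 0 * dP^[k] f := by
  induction k with
  | zero => rfl
  | succ k ih => simp only [Function.iterate_succ_apply', ih, dP_X_zero_mul]

lemma iterate_dX_X_one_mul (k : ℕ) (f : MvPolynomial (Fin 2) ℝ) :
    dX^[k] (X 1 * f) = X 1 * dX^[k] f := by
  induction k with
  | zero => rfl
  | succ k ih => simp only [Function.iterate_succ_apply', ih, dX_X_one_mul]

/-! ### Polynomials of bounded degree -/

/-- All monomials of `f` have degree less than `N`. -/
def DegreeBelow (N : ℕ) (f : MvPolynomial (Fin 2) ℝ) : Prop :=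
  ∀ m : Fin 2 →₀ ℕ, N ≤ m.degree → coeff m f = 0

lemma degreeBelow_totalDegree_succ (f : MvPolynomial (Fin 2) ℝ) :
    DegreeBelow (f.totalDegree + 1) f := fun m hm =>
  coeff_eq_zero_of_totalDegree_lt (by rw [← Finsupp.degree_apply]; omega)

lemma DegreeBelow.mono {N M : ℕ} {f : MvPolynomial (Fin 2) ℝ} (h : DegreeBelow N f)
    (hNM : N ≤ M) : DegreeBelow M f := fun m hm => h m (hNM.trans hm)

lemma DegreeBelow.eq_zero {f : MvPolynomial (Fin 2) ℝ} (h : DegreeBelow 0 f) : f = 0 := by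
  ext m
  simpa using h m (Nat.zero_le _)

lemma DegreeBelow.pderiv {N : ℕ} {f : MvPolynomial (Fin 2) ℝ} (i : Fin 2)
    (h : DegreeBelow (N + 1) f) : DegreeBelow N (pderiv i f) := by
  intro m hm
  rw [coeff_pderiv, h _ (by simpa using hm), zero_mul]

lemma DegreeBelow.iterate_dX {N : ℕ} {f : MvPolynomial (Fin 2) ℝ} (k : ℕ)
    (h : DegreeBelow (N + k) f) : DegreeBelow N (dX^[k] f) := by
  induction k generalizing f with
  | zero => exact h
  | succ k ih => exact ih (h.pderiv 0)

lemma DegreeBelow.iterate_dP {N : ℕ} {f : MvPolynomial (Fin 2) ℝ} (k : ℕ)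
    (h : DegreeBelow (N + k) f) : DegreeBelow N (dP^[k] f) := by
  induction k generalizing f with
  | zero => exact h
  | succ k ih => exact ih (h.pderiv 1)

lemma DegreeBelow.X_mul {N : ℕ} {f : MvPolynomial (Fin 2) ℝ} (i : Fin 2)
    (h : DegreeBelow N f) : DegreeBelow (N + 1) (X i * f) := by
  intro m hm
  rw [coeff_X_mul']
  split_ifs with hi
  · apply h
    have : (m - Finsupp.single i 1 + Finsupp.single i 1).degree = m.degree := by
      rw [tsub_add_cancel_of_le]
      rw [Finsupp.single_le_iff]
      exact Nat.one_le_iff_ne_zero.2 (Finsupp.mem_support_iff.1 hi)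
    rw [map_add, Finsupp.degree_single] at this
    omega
  · rfl

/-! ### Recursions for the Moyal product -/

/-- The `i`-th bidifferential operator in the Moyal product. -/
noncomputable def bidiff (i : ℕ) (f g : MvPolynomial (Fin 2) ℝ) : MvPolynomial (Fin 2) ℝ :=
  ∑ k ∈ Finset.range (i + 1),
    ((i.choose k : ℝ) * (-1 : ℝ) ^ k) • (dX^[i - k] (dP^[k] f) * dX^[k] (dP^[i - k] g))

lemma bidiff_eq_zero {N i : ℕ} {f : MvPolynomial (Fin 2) ℝ} (h : DegreeBelow N f) (hi : N ≤ i)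
    (g : MvPolynomial (Fin 2) ℝ) : bidiff i f g = 0 := by
  refine Finset.sum_eq_zero fun k hk => ?_
  have hk : k ≤ i := Nat.lt_succ_iff.1 (Finset.mem_range.1 hk)
  have h' : DegreeBelow 0 (dX^[i - k] (dP^[k] f)) :=
    DegreeBelow.iterate_dX _ (DegreeBelow.iterate_dP _ (h.mono (by omega)))
  rw [h'.eq_zero, zero_mul, smul_zero]

lemma bidiff_add_left (i : ℕ) (f₁ f₂ g : MvPolynomial (Fin 2) ℝ) :
    bidiff i (f₁ + f₂) g = bidiff i f₁ g + bidiff i f₂ g := by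
  simp only [bidiff, ← Finset.sum_add_distrib, iterate_dX_add, iterate_dP_add, add_mul, smul_add]

lemma bidiff_X_zero_mul (i : ℕ) (f g : MvPolynomial (Fin 2) ℝ) :
    bidiff (i + 1) (X 0 * f) g = X 0 * bidiff (i + 1) f g + ((i : ℝ) + 1) • bidiff i f (dP g) := by
  have h : ((i : ℝ) + 1) • bidiff i f (dP g) = ∑ k ∈ Finset.range (i + 1 + 1),
      (((i + 1).choose k : ℝ) * (-1 : ℝ) ^ k * ((i + 1 - k : ℕ) : ℝ)) •
        (dX^[i + 1 - k - 1] (dP^[k] f) * dX^[k] (dP^[i + 1 - k] g)) := by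
    rw [Finset.sum_range_succ, bidiff, Finset.smul_sum]
    simp only [Nat.sub_self, Nat.cast_zero, mul_zero, zero_smul, add_zero]
    refine Finset.sum_congr rfl fun k hk => ?_
    have hk : k ≤ i := Nat.lt_succ_iff.1 (Finset.mem_range.1 hk)
    have hc : (i.choose k : ℝ) * (i + 1) = (i + 1).choose k * ((i + 1 - k : ℕ) : ℝ) := by
      exact_mod_cast Nat.choose_mul_succ_eq i k
    rw [← Function.iterate_succ_apply dP, smul_smul, show (i - k).succ = i + 1 - k by omega,
      show i + 1 - k - 1 = i - k by omega]
    congr 1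
    linear_combination (-1 : ℝ) ^ k * hc
  rw [h, bidiff, bidiff, Finset.mul_sum, ← Finset.sum_add_distrib]
  refine Finset.sum_congr rfl fun k _ => ?_
  rw [iterate_dP_X_zero_mul, iterate_dX_X_zero_mul, mul_smul, ← smul_eq_mul (X 0)]
  simp only [smul_eq_mul, add_mul, smul_add, mul_smul_comm, smul_mul_assoc, mul_assoc, smul_smul]

lemma bidiff_X_one_mul (i : ℕ) (f g : MvPolynomial (Fin 2) ℝ) :
    bidiff (i + 1) (X 1 * f) g = X 1 * bidiff (i + 1) f g - ((i : ℝ) + 1) • bidiff i f (dX g) := by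
  have h : -(((i : ℝ) + 1) • bidiff i f (dX g)) = ∑ k ∈ Finset.range (i + 1 + 1),
      (((i + 1).choose k : ℝ) * (-1 : ℝ) ^ k * (k : ℝ)) •
        (dX^[i + 1 - k] (dP^[k - 1] f) * dX^[k] (dP^[i + 1 - k] g)) := by
    rw [Finset.sum_range_succ', bidiff, Finset.smul_sum, ← Finset.sum_neg_distrib]
    simp only [Nat.cast_zero, mul_zero, zero_smul, add_zero]
    refine Finset.sum_congr rfl fun k hk => ?_
    have hc : ((i : ℝ) + 1) * i.choose k = (i + 1).choose (k + 1) * (k + 1) := by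
      exact_mod_cast Nat.add_one_mul_choose_eq i k
    rw [Nat.add_sub_add_right, Nat.add_sub_cancel, ← (dX_dP_comm.iterate_right (i - k)).eq,
      ← Function.iterate_succ_apply dX, smul_smul, ← neg_smul]
    congr 1
    push_cast
    linear_combination -(-1 : ℝ) ^ k * hc
  rw [sub_eq_add_neg, h, bidiff, bidiff, Finset.mul_sum, ← Finset.sum_add_distrib]
  refine Finset.sum_congr rfl fun k _ => ?_
  rw [iterate_dP_X_one_mul, iterate_dX_add, iterate_dX_X_one_mul, iterate_dX_smul]
  simp only [add_mul, smul_add, mul_smul_comm, smul_mul_assoc, mul_assoc, smul_smul]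

lemma moyal_eq_sum (lam : ℝ) {N : ℕ} {f : MvPolynomial (Fin 2) ℝ} (h : DegreeBelow N f)
    (g : MvPolynomial (Fin 2) ℝ) :
    moyal lam f g = ∑ i ∈ Finset.range N, (lam ^ i / (i.factorial : ℝ)) • bidiff i f g := by
  refine finsum_eq_sum_of_support_subset _ fun i hi => ?_
  by_contra hN
  refine hi ?_
  change _ • bidiff i f g = 0
  rw [bidiff_eq_zero h (by simpa using hN), smul_zero]

lemma moyal_add_left (lam : ℝ) (f₁ f₂ g : MvPolynomial (Fin 2) ℝ) :
    moyal lam (f₁ + f₂) g = moyal lam f₁ g + moyal lam f₂ g := by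
  have h₁ := degreeBelow_totalDegree_succ f₁
  have h₂ := degreeBelow_totalDegree_succ f₂
  have h₃ := degreeBelow_totalDegree_succ (f₁ + f₂)
  set N := max (f₁.totalDegree + 1) (max (f₂.totalDegree + 1) ((f₁ + f₂).totalDegree + 1))
  rw [moyal_eq_sum lam (h₁.mono (M := N) (by omega)), moyal_eq_sum lam (h₂.mono (M := N) (by omega)),
    moyal_eq_sum lam (h₃.mono (M := N) (by omega)), ← Finset.sum_add_distrib]
  simp only [bidiff_add_left, smul_add]

lemma moyal_C (lam c : ℝ) (g : MvPolynomial (Fin 2) ℝ) : moyal lam (C c) g = c • g := by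
  have h : DegreeBelow 1 (C c) := fun m hm =>
    coeff_C_of_ne_zero (by rintro rfl; simp at hm) c
  rw [moyal_eq_sum lam h]
  simp [bidiff, smul_eq_C_mul]

lemma pow_div_factorial_succ_smul (lam : ℝ) (i : ℕ) (f : MvPolynomial (Fin 2) ℝ) :
    (lam ^ (i + 1) / ((i + 1).factorial : ℝ)) • ((i : ℝ) + 1) • f =
      lam • (lam ^ i / (i.factorial : ℝ)) • f := by
  rw [smul_smul, smul_smul, Nat.factorial_succ]
  congr 1
  push_cast
  have : (i : ℝ) + 1 ≠ 0 := by positivity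
  field_simp
  ring

lemma moyal_X_zero_mul (lam : ℝ) (f g : MvPolynomial (Fin 2) ℝ) :
    moyal lam (X 0 * f) g = X 0 * moyal lam f g + lam • moyal lam f (dP g) := by
  have h := degreeBelow_totalDegree_succ f
  rw [moyal_eq_sum lam (h.X_mul 0), moyal_eq_sum lam (h.mono (Nat.le_succ _)),
    moyal_eq_sum lam h, Finset.sum_range_succ', Finset.sum_range_succ' _ (f.totalDegree + 1),
    mul_add, Finset.mul_sum, Finset.smul_sum, add_right_comm, ← Finset.sum_add_distrib]
  congr 1
  · refine Finset.sum_congr rfl fun i _ => ?_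
    rw [bidiff_X_zero_mul, smul_add, pow_div_factorial_succ_smul, mul_smul_comm]
  · simp [bidiff, mul_assoc]

lemma moyal_X_one_mul (lam : ℝ) (f g : MvPolynomial (Fin 2) ℝ) :
    moyal lam (X 1 * f) g = X 1 * moyal lam f g - lam • moyal lam f (dX g) := by
  have h := degreeBelow_totalDegree_succ f
  rw [moyal_eq_sum lam (h.X_mul 1), moyal_eq_sum lam (h.mono (Nat.le_succ _)),
    moyal_eq_sum lam h, Finset.sum_range_succ', Finset.sum_range_succ' _ (f.totalDegree + 1),
    mul_add, Finset.mul_sum, Finset.smul_sum, add_sub_right_comm, ← Finset.sum_sub_distrib]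
  congr 1
  · refine Finset.sum_congr rfl fun i _ => ?_
    rw [bidiff_X_one_mul, smul_sub, pow_div_factorial_succ_smul, mul_smul_comm]
  · simp [bidiff, mul_assoc]

/-! ### Weyl quantization: the representation on polynomials in `p` -/

/-- Multiplication by `p` on `ℝ[p]`. -/
noncomputable def momentum : Module.End ℝ (Polynomial ℝ) := LinearMap.mulLeft ℝ Polynomial.X

/-- The operator `2λ d/dp` on `ℝ[p]`. -/
noncomputable def position (lam : ℝ) : Module.End ℝ (Polynomial ℝ) :=
  (2 * lam) • Polynomial.derivative

/-- The symmetrized product `M ↦ (A M + M A) / 2`. -/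
noncomputable def symMul (A : Module.End ℝ (Polynomial ℝ)) :
    Module.End ℝ (Module.End ℝ (Polynomial ℝ)) :=
  (1 / 2 : ℝ) • (LinearMap.mulLeft ℝ A + LinearMap.mulRight ℝ A)

lemma symMul_apply (A M : Module.End ℝ (Polynomial ℝ)) :
    symMul A M = (1 / 2 : ℝ) • (A * M + M * A) := rfl

lemma position_mul_momentum (lam : ℝ) :
    position lam * momentum = momentum * position lam + (2 * lam) • 1 := by
  refine LinearMap.ext fun q => ?_
  simp [position, momentum, smul_add, add_comm]

lemma symMul_commute (lam : ℝ) : Commute (symMul (position lam)) (symMul momentum) := by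
  refine LinearMap.ext fun M => ?_
  have h := position_mul_momentum lam
  have h₁ := congrArg (· * M) h
  have h₂ := congrArg (M * ·) h
  simp only [mul_add, add_mul, mul_assoc, smul_mul_assoc, mul_smul_comm, one_mul, mul_one]
    at h₁ h₂
  simp only [Module.End.mul_apply, symMul_apply, mul_add, add_mul, mul_assoc, smul_mul_assoc,
    mul_smul_comm]
  linear_combination (norm := module) (1 / 4 : ℝ) • h₁ - (1 / 4 : ℝ) • h₂

/-- The Weyl quantization, sending `x` to `2λ d/dp` and `p` to multiplication by `p`. -/
noncomputable def quantize (lam : ℝ) :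
    MvPolynomial (Fin 2) ℝ →ₗ[ℝ] Module.End ℝ (Polynomial ℝ) :=
  (basisMonomials (Fin 2) ℝ).constr ℝ fun m =>
    (symMul (position lam) ^ m 0 * symMul momentum ^ m 1) 1

lemma quantize_monomial (lam : ℝ) (m : Fin 2 →₀ ℕ) (c : ℝ) :
    quantize lam (monomial m c) =
      c • (symMul (position lam) ^ m 0 * symMul momentum ^ m 1) 1 := by
  have h : monomial m c = c • basisMonomials (Fin 2) ℝ m := by
    simp [coe_basisMonomials, smul_monomial]
  rw [h, map_smul, quantize, Module.Basis.constr_basis]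

lemma quantize_C (lam c : ℝ) : quantize lam (C c) = c • 1 := by
  simpa using quantize_monomial lam 0 c

lemma quantize_one (lam : ℝ) : quantize lam 1 = 1 := by
  simpa using quantize_C lam 1

lemma quantize_X_zero_mul (lam : ℝ) (f : MvPolynomial (Fin 2) ℝ) :
    quantize lam (X 0 * f) = symMul (position lam) (quantize lam f) := by
  induction f using MvPolynomial.induction_on' with
  | monomial m c =>
    rw [X, monomial_mul, one_mul, quantize_monomial, quantize_monomial, map_smul,
      ← Module.End.mul_apply, ← mul_assoc, ← pow_succ']
    simp [add_comm]
  | add f g hf hg => rw [mul_add, map_add, hf, hg, map_add, map_add]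

lemma quantize_X_one_mul (lam : ℝ) (f : MvPolynomial (Fin 2) ℝ) :
    quantize lam (X 1 * f) = symMul momentum (quantize lam f) := by
  induction f using MvPolynomial.induction_on' with
  | monomial m c =>
    rw [X, monomial_mul, one_mul, quantize_monomial, quantize_monomial, map_smul,
      ← Module.End.mul_apply, ← mul_assoc, ← ((symMul_commute lam).pow_left _).eq, mul_assoc,
      ← pow_succ']
    simp [add_comm]
  | add f g hf hg => rw [mul_add, map_add, hf, hg, map_add, map_add]

lemma position_mul_quantize (lam : ℝ) (f : MvPolynomial (Fin 2) ℝ) :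
    position lam * quantize lam f =
      quantize lam f * position lam + (2 * lam) • quantize lam (dP f) := by
  induction f using MvPolynomial.induction_on with
  | C a => simp [quantize_C, dP]
  | add f g hf hg =>
    simp only [dP_add, map_add, mul_add, add_mul, hf, hg, smul_add]
    abel
  | mul_X f i hf =>
    have h₁ (A) := congrArg (A * ·) hf
    have h₂ (A) := congrArg (· * A) hf
    simp only [mul_add, add_mul, mul_assoc, smul_mul_assoc, mul_smul_comm] at h₁ h₂
    rw [mul_comm f]
    fin_cases i
    · simp only [Fin.zero_eta, dP_X_zero_mul, quantize_X_zero_mul, symMul_apply, mul_add, add_mul,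
        mul_assoc, smul_mul_assoc, mul_smul_comm]
      linear_combination (norm := module)
        (1 / 2 : ℝ) • h₁ (position lam) + (1 / 2 : ℝ) • h₂ (position lam)
    · have h₃ := congrArg (· * quantize lam f) (position_mul_momentum lam)
      have h₄ := congrArg (quantize lam f * ·) (position_mul_momentum lam)
      simp only [mul_add, add_mul, mul_assoc, smul_mul_assoc, mul_smul_comm, one_mul, mul_one]
        at h₃ h₄
      simp only [Fin.mk_one, dP_X_one_mul, map_add, quantize_X_one_mul, symMul_apply, mul_add,
        add_mul, mul_assoc, smul_mul_assoc, mul_smul_comm]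
      linear_combination (norm := module)
        (1 / 2 : ℝ) • h₁ momentum + (1 / 2 : ℝ) • h₂ momentum + (1 / 2 : ℝ) • h₃
          + (1 / 2 : ℝ) • h₄

lemma momentum_mul_quantize (lam : ℝ) (f : MvPolynomial (Fin 2) ℝ) :
    momentum * quantize lam f =
      quantize lam f * momentum - (2 * lam) • quantize lam (dX f) := by
  induction f using MvPolynomial.induction_on with
  | C a => simp [quantize_C, dX]
  | add f g hf hg =>
    simp only [dX_add, map_add, mul_add, add_mul, hf, hg, smul_add]
    abel
  | mul_X f i hf =>
    have h₁ (A) := congrArg (A * ·) hf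
    have h₂ (A) := congrArg (· * A) hf
    simp only [mul_sub, sub_mul, mul_assoc, smul_mul_assoc, mul_smul_comm] at h₁ h₂
    rw [mul_comm f]
    fin_cases i
    · have h₃ := congrArg (· * quantize lam f) (position_mul_momentum lam)
      have h₄ := congrArg (quantize lam f * ·) (position_mul_momentum lam)
      simp only [mul_add, add_mul, mul_assoc, smul_mul_assoc, mul_smul_comm, one_mul, mul_one]
        at h₃ h₄
      simp only [Fin.zero_eta, dX_X_zero_mul, map_add, quantize_X_zero_mul, symMul_apply, mul_add,
        add_mul, mul_assoc, smul_mul_assoc, mul_smul_comm]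
      linear_combination (norm := module)
        (1 / 2 : ℝ) • h₁ (position lam) + (1 / 2 : ℝ) • h₂ (position lam) - (1 / 2 : ℝ) • h₃
          - (1 / 2 : ℝ) • h₄
    · simp only [Fin.mk_one, dX_X_one_mul, quantize_X_one_mul, symMul_apply, mul_add, add_mul,
        mul_assoc, smul_mul_assoc, mul_smul_comm]
      linear_combination (norm := module)
        (1 / 2 : ℝ) • h₁ momentum + (1 / 2 : ℝ) • h₂ momentum

lemma quantize_moyal (lam : ℝ) (f g : MvPolynomial (Fin 2) ℝ) :
    quantize lam (moyal lam f g) = quantize lam f * quantize lam g := by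
  induction f using MvPolynomial.induction_on generalizing g with
  | C a => rw [moyal_C, map_smul, quantize_C, smul_mul_assoc, one_mul]
  | add f₁ f₂ h₁ h₂ => rw [moyal_add_left, map_add, h₁, h₂, map_add, add_mul]
  | mul_X f i ih =>
    rw [mul_comm f]
    fin_cases i
    · have h := congrArg (quantize lam f * ·) (position_mul_quantize lam g)
      simp only [mul_add, mul_smul_comm] at h
      simp only [Fin.zero_eta, moyal_X_zero_mul, map_add, map_smul, quantize_X_zero_mul, ih,
        symMul_apply, add_mul, mul_assoc, smul_mul_assoc]
      linear_combination (norm := module) (-1 / 2 : ℝ) • h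
    · have h := congrArg (quantize lam f * ·) (momentum_mul_quantize lam g)
      simp only [mul_sub, mul_smul_comm] at h
      simp only [Fin.mk_one, moyal_X_one_mul, map_sub, map_smul, quantize_X_one_mul, ih,
        symMul_apply, add_mul, mul_assoc, smul_mul_assoc]
      linear_combination (norm := module) (-1 / 2 : ℝ) • h

lemma quantize_eq_zero_of_degreeBelow {lam : ℝ} (hlam : lam ≠ 0) {N : ℕ}
    {f : MvPolynomial (Fin 2) ℝ} (hN : DegreeBelow N f) (hf : quantize lam f = 0) : f = 0 := by
  induction N generalizing f with
  | zero => exact hN.eq_zero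
  | succ N ih =>
    have hX : dX f = 0 := by
      refine ih (hN.pderiv 0) ?_
      simpa [hf, hlam] using momentum_mul_quantize lam f
    have hP : dP f = 0 := by
      refine ih (hN.pderiv 1) ?_
      simpa [hf, hlam] using (position_mul_quantize lam f).symm
    have hd : ∀ i, pderiv i f = 0 := by
      intro i
      fin_cases i
      exacts [hX, hP]
    have hC : f = C (coeff 0 f) := by
      ext m
      by_cases hm : m = 0
      · simp [hm]
      obtain ⟨i, hi⟩ := Finsupp.ne_iff.1 hm
      have hle : Finsupp.single i 1 ≤ m :=
        Finsupp.single_le_iff.2 (Nat.one_le_iff_ne_zero.2 hi)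
      have h := coeff_pderiv (i := i) f (m - Finsupp.single i 1)
      rw [hd, tsub_add_cancel_of_le hle, coeff_zero, eq_comm, mul_eq_zero] at h
      rw [coeff_C_of_ne_zero hm]
      refine h.resolve_right ?_
      positivity
    rw [hC, quantize_C] at hf
    have h0 : coeff 0 f = 0 := (smul_eq_zero.1 hf).resolve_right one_ne_zero
    rw [hC, h0, C_0]

lemma quantize_injective {lam : ℝ} (hlam : lam ≠ 0) : Function.Injective (quantize lam) :=
  (injective_iff_map_eq_zero _).2 fun f =>
    quantize_eq_zero_of_degreeBelow hlam (degreeBelow_totalDegree_succ f)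

lemma dP_toMv (q : Polynomial ℝ) : dP (toMv q) = toMv (Polynomial.derivative q) := by
  simp [dP, toMv, Derivation.map_aeval]

lemma quantize_toMv (lam : ℝ) (q : Polynomial ℝ) :
    quantize lam (toMv q) = LinearMap.mulLeft ℝ q := by
  have hpow : ∀ k : ℕ,
      quantize lam (X 1 ^ k) = LinearMap.mulLeft ℝ ((Polynomial.X : Polynomial ℝ) ^ k) := by
    intro k
    induction k with
    | zero => rw [pow_zero, pow_zero, quantize_one, LinearMap.mulLeft_one, Module.End.one_eq_id]
    | succ k ih =>
      refine LinearMap.ext fun u => ?_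
      rw [pow_succ', quantize_X_one_mul, ih, symMul_apply]
      simp only [momentum, LinearMap.smul_apply, LinearMap.add_apply, Module.End.mul_apply,
        LinearMap.mulLeft_apply]
      rw [show Polynomial.X ^ k * (Polynomial.X * u) = Polynomial.X * (Polynomial.X ^ k * u) by ring,
        pow_succ', mul_assoc]
      module
  induction q using Polynomial.induction_on' with
  | add q r hq hr =>
    refine LinearMap.ext fun u => ?_
    simp only [toMv, map_add] at hq hr ⊢
    rw [hq, hr]
    simp [add_mul]
  | monomial k c =>
    refine LinearMap.ext fun u => ?_
    rw [toMv, Polynomial.aeval_monomial, ← Algebra.smul_def, map_smul, hpow]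
    simp [← Polynomial.smul_X_eq_monomial]

lemma quantize_X_zero_pow (lam : ℝ) (k : ℕ) : quantize lam (X 0 ^ k) = position lam ^ k := by
  induction k with
  | zero => simpa using quantize_one lam
  | succ k ih =>
    rw [pow_succ', quantize_X_zero_mul, ih, symMul_apply, ← pow_succ', ← pow_succ]
    module

lemma quantize_X_zero_mul' (lam : ℝ) (f : MvPolynomial (Fin 2) ℝ) :
    quantize lam (X 0 * f) = quantize lam f * position lam + lam • quantize lam (dP f) := by
  rw [quantize_X_zero_mul, symMul_apply, position_mul_quantize]
  module

/-- Right division by `x` leaves a remainder in `ℝ[p]`. -/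
lemma exists_quantize_eq_mul_position_add (lam : ℝ) (f : MvPolynomial (Fin 2) ℝ) :
    ∃ (g : MvPolynomial (Fin 2) ℝ) (q : Polynomial ℝ),
      quantize lam f = quantize lam g * position lam + LinearMap.mulLeft ℝ q := by
  have hpow : ∀ (a : ℕ) (u : Polynomial ℝ), ∃ (g : MvPolynomial (Fin 2) ℝ) (q : Polynomial ℝ),
      quantize lam (X 0 ^ a * toMv u) =
        quantize lam g * position lam + LinearMap.mulLeft ℝ q := by
    intro a
    induction a with
    | zero => exact fun u => ⟨0, u, by simp [quantize_toMv]⟩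
    | succ a ih =>
      intro u
      obtain ⟨g, q, h⟩ := ih (Polynomial.derivative u)
      have hd : dP (X 0 ^ a * toMv u) = X 0 ^ a * toMv (Polynomial.derivative u) := by
        rw [← dP_toMv]
        simp [dP]
      refine ⟨X 0 ^ a * toMv u + lam • g, lam • q, ?_⟩
      rw [pow_succ', mul_assoc, quantize_X_zero_mul', hd, h, map_add, map_smul, add_mul, smul_add,
        smul_mul_assoc, add_assoc]
      congr 2
      refine LinearMap.ext fun v => ?_
      simp
  induction f using MvPolynomial.induction_on' with
  | monomial m c =>
    have h : monomial m c = X 0 ^ m 0 * toMv (Polynomial.monomial (m 1) c) := by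
      rw [toMv, Polynomial.aeval_monomial, monomial_eq, Finsupp.prod_fintype _ _ (by simp),
        Fin.prod_univ_two, algebraMap_eq]
      ring
    rw [h]
    exact hpow _ _
  | add f₁ f₂ h₁ h₂ =>
    obtain ⟨g₁, q₁, h₁⟩ := h₁
    obtain ⟨g₂, q₂, h₂⟩ := h₂
    refine ⟨g₁ + g₂, q₁ + q₂, ?_⟩
    rw [map_add, h₁, h₂, map_add, add_mul, add_add_add_comm]
    congr 1
    refine LinearMap.ext fun v => ?_
    simp [add_mul]

lemma position_X_pow_succ (lam : ℝ) (i : ℕ) :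
    position lam (Polynomial.X ^ (i + 1)) = (2 * lam * (i + 1)) • Polynomial.X ^ i := by
  simp [position, Polynomial.smul_eq_C_mul, mul_assoc]

lemma position_pow_apply (lam : ℝ) (n : ℕ) (q : Polynomial ℝ) :
    (position lam ^ n) q = (2 * lam) ^ n • Polynomial.derivative^[n] q := by
  rw [position, smul_pow, LinearMap.smul_apply, Module.End.pow_apply]

lemma position_pow_apply_eq_zero {lam : ℝ} (hlam : lam ≠ 0) (n : ℕ) (q : Polynomial ℝ) :
    (position lam ^ n) q = 0 ↔ ∀ i, n ≤ i → q.coeff i = 0 := by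
  have hc : (2 * lam) ^ n ≠ 0 := pow_ne_zero _ (mul_ne_zero two_ne_zero hlam)
  rw [position_pow_apply, smul_eq_zero, or_iff_right hc, Polynomial.ext_iff]
  simp only [Polynomial.coeff_iterate_derivative, Polynomial.coeff_zero, nsmul_eq_mul,
    mul_eq_zero, Nat.cast_eq_zero, Nat.descFactorial_eq_zero_iff_lt]
  constructor
  · intro h i hi
    have := h (i - n)
    rw [Nat.sub_add_cancel hi] at this
    exact this.resolve_left (by omega)
  · exact fun h i => Or.inr (h _ (by omega))

lemma exists_quantize_eq_mul_position_pow {lam : ℝ} (hlam : lam ≠ 0) (n : ℕ)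
    (f : MvPolynomial (Fin 2) ℝ) (hf : ∀ i < n, quantize lam f (Polynomial.X ^ i) = 0) :
    ∃ g, quantize lam f = quantize lam g * position lam ^ n := by
  induction n generalizing f with
  | zero => exact ⟨f, by simp⟩
  | succ n ih =>
    obtain ⟨g, q, h⟩ := exists_quantize_eq_mul_position_add lam f
    have hq : q = 0 := by
      have h0 := hf 0 (Nat.succ_pos n)
      rw [h] at h0
      simpa [position] using h0
    have h' : quantize lam f = quantize lam g * position lam := by
      rw [h, hq]
      simp
    obtain ⟨g', hg'⟩ := ih g fun i hi => by
      have hi := hf (i + 1) (Nat.succ_lt_succ hi)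
      rw [h', Module.End.mul_apply, position_X_pow_succ, map_smul, smul_eq_zero] at hi
      refine hi.resolve_left (mul_ne_zero (mul_ne_zero two_ne_zero hlam) ?_)
      positivity
    exact ⟨g', by rw [h', hg', pow_succ, mul_assoc]⟩

lemma mem_Jl_iff {lam : ℝ} (hlam : lam ≠ 0) (n : ℕ) (f : MvPolynomial (Fin 2) ℝ) :
    f ∈ Jl lam n ↔ ∀ i < n, quantize lam f (Polynomial.X ^ i) = 0 := by
  constructor
  · rintro ⟨g, rfl⟩ i hi
    rw [quantize_moyal, quantize_X_zero_pow, Module.End.mul_apply,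
      (position_pow_apply_eq_zero hlam n _).2, map_zero]
    intro j hj
    rw [Polynomial.coeff_X_pow, if_neg (by omega)]
  · intro h
    obtain ⟨g, hg⟩ := exists_quantize_eq_mul_position_pow hlam n f h
    refine ⟨g, quantize_injective hlam ?_⟩
    rw [hg, quantize_moyal, quantize_X_zero_pow]

lemma mem_Nl_iff {lam : ℝ} (hlam : lam ≠ 0) (n : ℕ) (f : MvPolynomial (Fin 2) ℝ) :
    f ∈ Nl lam n ↔
      ∀ j < n, ∀ i, n ≤ i → (quantize lam f (Polynomial.X ^ j)).coeff i = 0 := by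
  change moyal lam (X 0 ^ n) f ∈ Jl lam n ↔ _
  simp only [mem_Jl_iff hlam, quantize_moyal, quantize_X_zero_pow, Module.End.mul_apply,
    position_pow_apply_eq_zero hlam]

lemma exists_quantize_X_pow_eq {lam : ℝ} (hlam : lam ≠ 0) (u : ℕ → Polynomial ℝ) (n : ℕ) :
    ∃ f, ∀ i < n, quantize lam f (Polynomial.X ^ i) = u i := by
  induction n with
  | zero => exact ⟨0, by simp⟩
  | succ n ih =>
    obtain ⟨f, hf⟩ := ih
    set c : ℝ := (2 * lam) ^ n * (n.factorial : ℝ)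
    have hc : c ≠ 0 := mul_ne_zero (pow_ne_zero _ (mul_ne_zero two_ne_zero hlam))
      (Nat.cast_ne_zero.2 n.factorial_ne_zero)
    have hXn : (position lam ^ n) (Polynomial.X ^ n) = c • 1 := by
      rw [position_pow_apply, Polynomial.iterate_derivative_X_pow_eq_smul]
      simp [c, Nat.descFactorial_self, mul_smul, Nat.cast_smul_eq_nsmul]
    refine ⟨f + moyal lam (toMv (c⁻¹ • (u n - quantize lam f (Polynomial.X ^ n)))) (X 0 ^ n),
      fun i hi => ?_⟩
    rw [map_add, quantize_moyal, quantize_toMv, quantize_X_zero_pow, LinearMap.add_apply,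
      Module.End.mul_apply]
    rcases Nat.lt_succ_iff_lt_or_eq.1 hi with hi | rfl
    · rw [(position_pow_apply_eq_zero hlam n _).2, map_zero, add_zero, hf i hi]
      intro j hj
      rw [Polynomial.coeff_X_pow, if_neg (by omega)]
    · rw [hXn]
      simp [smul_smul, hc]

/-- The matrix, in the basis `1, p, …, p^(n-1)`, of the compression of `quantize lam f` to
polynomials of degree less than `n`. -/
noncomputable def toMatrix (lam : ℝ) (n : ℕ) (f : MvPolynomial (Fin 2) ℝ) :
    Matrix (Fin n) (Fin n) ℝ :=
  Matrix.of fun i j => (quantize lam f (Polynomial.X ^ (j : ℕ))).coeff i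

lemma toMatrix_moyal {lam : ℝ} (hlam : lam ≠ 0) {n : ℕ} (f : MvPolynomial (Fin 2) ℝ)
    {g : MvPolynomial (Fin 2) ℝ} (hg : g ∈ Nl lam n) :
    toMatrix lam n (moyal lam f g) = toMatrix lam n f * toMatrix lam n g := by
  ext i j
  have h := (mem_Nl_iff hlam n g).1 hg j j.2
  rw [toMatrix, Matrix.of_apply, quantize_moyal, Module.End.mul_apply, Matrix.mul_apply]
  set q := quantize lam g (Polynomial.X ^ (j : ℕ)) with hq
  have hsum : q = ∑ k : Fin n, q.coeff k • Polynomial.X ^ (k : ℕ) := by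
    rw [Fin.sum_univ_eq_sum_range fun k => q.coeff k • (Polynomial.X : Polynomial ℝ) ^ k]
    ext i
    rcases lt_or_ge i n with hi | hi
    · simp [Polynomial.finsetSum_coeff, Polynomial.coeff_X_pow, hi]
    · simp [Polynomial.finsetSum_coeff, Polynomial.coeff_X_pow, h i hi]
  conv_lhs => rw [hsum]
  simp [toMatrix, ← hq, mul_comm]

lemma moyal_mem_Nl {lam : ℝ} {n : ℕ} {f g : MvPolynomial (Fin 2) ℝ} (hlam : lam ≠ 0)
    (hf : f ∈ Nl lam n) (hg : g ∈ Nl lam n) : moyal lam f g ∈ Nl lam n := by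
  obtain ⟨u, hu⟩ := hf
  obtain ⟨v, hv⟩ := hg
  refine ⟨moyal lam u v, quantize_injective hlam ?_⟩
  have hu := congrArg (quantize lam) hu
  have hv := congrArg (quantize lam) hv
  simp only [quantize_moyal] at hu hv ⊢
  rw [← mul_assoc, hu, mul_assoc, hv, mul_assoc]

end Moyal

/-- Theorem 3.5: for every λ ≠ 0 the quotient algebra Q = N_l/J_l (with the
product induced by *_λ) is isomorphic as an ℝ-algebra to Mat_n(ℝ).  The isomorphism is
encoded by a map ψ which, on N_l, is ℝ-linear, multiplicative (Moyal product to matrix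
product), unital, surjective onto Mat_n(ℝ), and whose kernel on N_l is exactly J_l. -/
theorem theorem_3_5 (lam : ℝ) (hlam : lam ≠ 0) (n : ℕ) (hn : 1 ≤ n) :
    ∃ ψ : MvPolynomial (Fin 2) ℝ → Matrix (Fin n) (Fin n) ℝ,
      (∀ f ∈ Nl lam n, ∀ g ∈ Nl lam n, ψ (f + g) = ψ f + ψ g) ∧
      (∀ (c : ℝ), ∀ f ∈ Nl lam n, ψ (c • f) = c • ψ f) ∧
      (∀ f ∈ Nl lam n, ∀ g ∈ Nl lam n,
        moyal lam f g ∈ Nl lam n ∧ ψ (moyal lam f g) = ψ f * ψ g) ∧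
      ((1 : MvPolynomial (Fin 2) ℝ) ∈ Nl lam n ∧ ψ 1 = 1) ∧
      (∀ A : Matrix (Fin n) (Fin n) ℝ, ∃ f ∈ Nl lam n, ψ f = A) ∧
      (∀ f ∈ Nl lam n, (ψ f = 0 ↔ f ∈ Jl lam n)) := by
  refine ⟨Moyal.toMatrix lam n, fun f _ g _ => ?_, fun c f _ => ?_,
    fun f hf g hg => ⟨Moyal.moyal_mem_Nl hlam hf hg, Moyal.toMatrix_moyal hlam f hg⟩,
    ⟨?_, ?_⟩, fun A => ?_, fun f hf => ?_⟩
  · ext i j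
    simp [Moyal.toMatrix]
  · ext i j
    simp [Moyal.toMatrix]
  · rw [Moyal.mem_Nl_iff hlam]
    intro j hj i hi
    rw [Moyal.quantize_one, Module.End.one_apply, Polynomial.coeff_X_pow, if_neg (by omega)]
  · ext i j
    simp [Moyal.toMatrix, Moyal.quantize_one, Polynomial.coeff_X_pow, Matrix.one_apply, Fin.ext_iff]
  · obtain ⟨f, hf⟩ := Moyal.exists_quantize_X_pow_eq hlam (fun j => if hj : j < n then
      ∑ i : Fin n, Polynomial.monomial (i : ℕ) (A i ⟨j, hj⟩) else 0) n
    refine ⟨f, (Moyal.mem_Nl_iff hlam n f).2 fun j hj i hi => ?_, ?_⟩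
    · rw [hf j hj, dif_pos hj, Polynomial.finsetSum_coeff]
      refine Finset.sum_eq_zero fun k _ => ?_
      rw [Polynomial.coeff_monomial, if_neg (by omega)]
    · ext i j
      rw [Moyal.toMatrix, Matrix.of_apply, hf j j.2, dif_pos j.2]
      simp [Polynomial.coeff_monomial, ← Fin.ext_iff]
  · rw [Moyal.mem_Jl_iff hlam]
    rw [Moyal.mem_Nl_iff hlam] at hf
    constructor
    · intro h j hj
      ext i
      rcases lt_or_ge i n with hi | hi
      · exact congrFun (congrFun h ⟨i, hi⟩) ⟨j, hj⟩
      · exact hf j hj i hi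
    · intro h
      ext i j
      simp [Moyal.toMatrix, h j j.2]
end

section
/- (Module structure on V, from the proof of Theorem 3.5.) Let J_l := {g *_λ x^n : g ∈ ℝ[x,p]}. Let h = Σ_{i=0}^{n−1} h_i *_λ x^i with h_i ∈ ℝ[p]. Then for every k = 0, 1, …, n−1, h *_λ (p^k *_λ x^{n−1}) − g_k *_λ x^{n−1} ∈ J_l, where g_k := Σ_{i=0}^{k} (2λ)^i h_i · (d^i p^k/dp^i) ∈ ℝ[p]. -/
/- The Moyal product on ℝ[x,p], where x = X 0 and p = X 1 in `MvPolynomial (Fin 2) ℝ`: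
   f *_λ g := Σ_{i=0}^∞ (λ^i/i!) Σ_{k=0}^i C(i,k) (−1)^k (∂_x^{i−k}∂_p^k f)·(∂_x^k ∂_p^{i−k} g).
   On polynomials only finitely many terms are nonzero, so the `finsum` below is faithful. -/

open MvPolynomial

/-- The `i`-th power of the Poisson bidifferential operator `∂_x ⊗ ∂_p - ∂_p ⊗ ∂_x`, followed by
multiplication. -/
noncomputable def poissonPow : ℕ →
    MvPolynomial (Fin 2) ℝ →ₗ[ℝ] MvPolynomial (Fin 2) ℝ →ₗ[ℝ] MvPolynomial (Fin 2) ℝ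
  | 0 => LinearMap.mul ℝ (MvPolynomial (Fin 2) ℝ)
  | i + 1 =>
    (poissonPow i).compl₁₂ (pderiv (0 : Fin 2)).toLinearMap (pderiv (1 : Fin 2)).toLinearMap -
      (poissonPow i).compl₁₂ (pderiv (1 : Fin 2)).toLinearMap (pderiv (0 : Fin 2)).toLinearMap

theorem poissonPow_zero (f g : MvPolynomial (Fin 2) ℝ) : poissonPow 0 f g = f * g := rfl

theorem poissonPow_succ (i : ℕ) (f g : MvPolynomial (Fin 2) ℝ) :
    poissonPow (i + 1) f g = poissonPow i (dX f) (dP g) - poissonPow i (dP f) (dX g) := rfl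

theorem dX_add (f g : MvPolynomial (Fin 2) ℝ) : dX (f + g) = dX f + dX g := map_add _ _ _

theorem dP_add (f g : MvPolynomial (Fin 2) ℝ) : dP (f + g) = dP f + dP g := map_add _ _ _

theorem dX_sub (f g : MvPolynomial (Fin 2) ℝ) : dX (f - g) = dX f - dX g := map_sub _ _ _

theorem dP_sub (f g : MvPolynomial (Fin 2) ℝ) : dP (f - g) = dP f - dP g := map_sub _ _ _

theorem dX_mul (f g : MvPolynomial (Fin 2) ℝ) : dX (f * g) = dX f * g + f * dX g := by
  simp only [dX, Derivation.leibniz, smul_eq_mul]; ring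

theorem dP_mul (f g : MvPolynomial (Fin 2) ℝ) : dP (f * g) = dP f * g + f * dP g := by
  simp only [dP, Derivation.leibniz, smul_eq_mul]; ring

theorem dX_smul (c : ℝ) (f : MvPolynomial (Fin 2) ℝ) : dX (c • f) = c • dX f :=
  Derivation.map_smul _ _ _

theorem dP_smul (c : ℝ) (f : MvPolynomial (Fin 2) ℝ) : dP (c • f) = c • dP f :=
  Derivation.map_smul _ _ _

@[simp] theorem dX_C (c : ℝ) : dX (C c) = 0 := by simp [dX]

@[simp] theorem dP_C (c : ℝ) : dP (C c) = 0 := by simp [dP]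

@[simp] theorem dX_X_zero : dX (X 0) = 1 := by simp [dX]

@[simp] theorem dX_X_one : dX (X 1) = 0 := by simp [dX, pderiv_X]

@[simp] theorem dP_X_zero : dP (X 0) = 0 := by simp [dP, pderiv_X]

@[simp] theorem dP_X_one : dP (X 1) = 1 := by simp [dP]

theorem dX_dP_comm (f : MvPolynomial (Fin 2) ℝ) : dX (dP f) = dP (dX f) := by
  induction f using MvPolynomial.induction_on with
  | C a => simp [dX, dP]
  | add f g hf hg => simp only [dX_add, dP_add, hf, hg]
  | mul_X f j hf =>
    fin_cases j <;> simp [dX_mul, dP_mul, dX_add, dP_add, hf]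

theorem sum_choose_eq_poissonPow (i : ℕ) (f g : MvPolynomial (Fin 2) ℝ) :
    ∑ k ∈ Finset.range (i + 1),
      ((i.choose k : ℝ) * (-1 : ℝ) ^ k) • (dX^[i - k] (dP^[k] f) * dX^[k] (dP^[i - k] g)) =
    poissonPow i f g := by
  have key : ∀ (i : ℕ) (f g : MvPolynomial (Fin 2) ℝ),
      ∑ ij ∈ Finset.HasAntidiagonal.antidiagonal i, i.choose ij.1 •
        ((-1 : ℝ) ^ ij.1 • (dX^[ij.2] (dP^[ij.1] f) * dX^[ij.1] (dP^[ij.2] g))) =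
      poissonPow i f g := by
    have hXP : Function.Commute dX dP := dX_dP_comm
    intro i
    induction i with
    | zero => intro f g; simp [poissonPow_zero]
    | succ i ih =>
      intro f g
      rw [Finset.sum_antidiagonal_choose_succ_nsmul
        (fun a b => (-1 : ℝ) ^ a • (dX^[b] (dP^[a] f) * dX^[a] (dP^[b] g))),
        poissonPow_succ, ← ih, ← ih, sub_eq_add_neg, ← Finset.sum_neg_distrib]
      congr 1
      · refine Finset.sum_congr rfl fun ij _ => ?_
        rw [Function.iterate_succ_apply, Function.iterate_succ_apply,
          (hXP.iterate_right ij.1).eq f]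
      · refine Finset.sum_congr rfl fun ij hij => ?_
        rw [Function.iterate_succ_apply, Function.iterate_succ_apply,
          (hXP.iterate_right ij.2).eq g, pow_succ, mul_neg_one, neg_smul, smul_neg,
          Nat.choose_symm_of_eq_add (Finset.HasAntidiagonal.mem_antidiagonal.mp hij).symm]
  rw [← key, Finset.Nat.sum_antidiagonal_eq_sum_range_succ (fun a b => i.choose a •
    ((-1 : ℝ) ^ a • (dX^[b] (dP^[a] f) * dX^[a] (dP^[b] g))))]
  refine Finset.sum_congr rfl fun k _ => ?_
  rw [mul_smul, Nat.cast_smul_eq_nsmul]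

theorem moyal_eq_finsum (lam : ℝ) (f g : MvPolynomial (Fin 2) ℝ) :
    moyal lam f g = ∑ᶠ i : ℕ, (lam ^ i / (i.factorial : ℝ)) • poissonPow i f g := by
  simp only [moyal, sum_choose_eq_poissonPow]

theorem poissonPow_X_zero_mul (i : ℕ) (f g : MvPolynomial (Fin 2) ℝ) :
    poissonPow (i + 1) (X 0 * f) g =
      X 0 * poissonPow (i + 1) f g + ((i + 1 : ℕ) : ℝ) • poissonPow i f (dP g) := by
  induction i generalizing f g with
  | zero => simp [poissonPow_succ, poissonPow_zero, dX_mul, dP_mul]; ring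
  | succ i ih =>
    rw [poissonPow_succ (i + 1), poissonPow_succ (i + 1) f, poissonPow_succ i f (dP g), dX_mul,
      dP_mul, dX_X_zero, dP_X_zero, one_mul, zero_mul, zero_add, map_add, LinearMap.add_apply, ih,
      ih, poissonPow_succ i f (dP g), dX_dP_comm]
    simp only [smul_eq_C_mul, Nat.cast_add, Nat.cast_one, map_add, map_one]
    ring

theorem poissonPow_X_one_mul (i : ℕ) (f g : MvPolynomial (Fin 2) ℝ) :
    poissonPow (i + 1) (X 1 * f) g =
      X 1 * poissonPow (i + 1) f g - ((i + 1 : ℕ) : ℝ) • poissonPow i f (dX g) := by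
  induction i generalizing f g with
  | zero => simp [poissonPow_succ, poissonPow_zero, dX_mul, dP_mul]; ring
  | succ i ih =>
    rw [poissonPow_succ (i + 1), poissonPow_succ (i + 1) f, poissonPow_succ i f (dX g), dX_mul,
      dP_mul, dX_X_one, dP_X_one, one_mul, zero_mul, zero_add, map_add, LinearMap.add_apply, ih,
      ih, poissonPow_succ i f (dX g), dX_dP_comm]
    simp only [smul_eq_C_mul, Nat.cast_add, Nat.cast_one, map_add, map_one]
    ring

theorem poissonPow_C (i : ℕ) (c : ℝ) (g : MvPolynomial (Fin 2) ℝ) :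
    poissonPow (i + 1) (C c) g = 0 := by
  simp [poissonPow_succ]

theorem exists_poissonPow_eq_zero (f g : MvPolynomial (Fin 2) ℝ) :
    ∃ N, ∀ i, N ≤ i → poissonPow i f g = 0 := by
  induction f using MvPolynomial.induction_on generalizing g with
  | C a =>
    refine ⟨1, fun i hi => ?_⟩
    obtain ⟨i, rfl⟩ := Nat.exists_eq_add_of_le' hi
    exact poissonPow_C i a g
  | add f₁ f₂ h₁ h₂ =>
    obtain ⟨N₁, h₁⟩ := h₁ g
    obtain ⟨N₂, h₂⟩ := h₂ g
    refine ⟨max N₁ N₂, fun i hi => ?_⟩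
    rw [map_add, LinearMap.add_apply, h₁ i (by omega), h₂ i (by omega), add_zero]
  | mul_X f j hf =>
    have step : ∀ d : MvPolynomial (Fin 2) ℝ, ∃ N, ∀ i, N ≤ i →
        poissonPow (i + 1) f g = 0 ∧ poissonPow i f d = 0 := fun d => by
      obtain ⟨N₁, h₁⟩ := hf g
      obtain ⟨N₂, h₂⟩ := hf d
      exact ⟨max N₁ N₂, fun i hi => ⟨h₁ _ (by omega), h₂ _ (by omega)⟩⟩
    fin_cases j
    · obtain ⟨N, hN⟩ := step (dP g)
      refine ⟨N + 1, fun i hi => ?_⟩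
      obtain ⟨i, rfl⟩ := Nat.exists_eq_add_of_le' (show 1 ≤ i by omega)
      obtain ⟨h₁, h₂⟩ := hN i (by omega)
      simp [mul_comm f, poissonPow_X_zero_mul, h₁, h₂]
    · obtain ⟨N, hN⟩ := step (dX g)
      refine ⟨N + 1, fun i hi => ?_⟩
      obtain ⟨i, rfl⟩ := Nat.exists_eq_add_of_le' (show 1 ≤ i by omega)
      obtain ⟨h₁, h₂⟩ := hN i (by omega)
      simp [mul_comm f, poissonPow_X_one_mul, h₁, h₂]

theorem finite_support_moyal (lam : ℝ) (f g : MvPolynomial (Fin 2) ℝ) :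
    (Function.support fun i : ℕ =>
      (lam ^ i / (i.factorial : ℝ)) • poissonPow i f g).Finite := by
  obtain ⟨N, hN⟩ := exists_poissonPow_eq_zero f g
  refine (Set.finite_Iio N).subset fun i hi => ?_
  by_contra h
  exact hi (by simp [hN i (not_lt.mp h)])

theorem moyal_eq_sum (lam : ℝ) (f g : MvPolynomial (Fin 2) ℝ) :
    ∃ N, ∀ M, N ≤ M →
      moyal lam f g =
        ∑ i ∈ Finset.range M, (lam ^ i / (i.factorial : ℝ)) • poissonPow i f g := by
  obtain ⟨N, hN⟩ := exists_poissonPow_eq_zero f g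
  refine ⟨N, fun M hM => ?_⟩
  rw [moyal_eq_finsum]
  refine finsum_eq_sum_of_support_subset _ fun i hi => ?_
  by_contra h
  simp only [Finset.coe_range, Set.mem_Iio, not_lt] at h
  exact hi (by simp [hN i (hM.trans h)])

theorem moyal_add_left (lam : ℝ) (f₁ f₂ g : MvPolynomial (Fin 2) ℝ) :
    moyal lam (f₁ + f₂) g = moyal lam f₁ g + moyal lam f₂ g := by
  simp only [moyal_eq_finsum, map_add, LinearMap.add_apply, smul_add]
  exact finsum_add_distrib (finite_support_moyal ..) (finite_support_moyal ..)

theorem moyal_add_right (lam : ℝ) (f g₁ g₂ : MvPolynomial (Fin 2) ℝ) :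
    moyal lam f (g₁ + g₂) = moyal lam f g₁ + moyal lam f g₂ := by
  simp only [moyal_eq_finsum, map_add, smul_add]
  exact finsum_add_distrib (finite_support_moyal ..) (finite_support_moyal ..)

theorem moyal_smul_left (lam c : ℝ) (f g : MvPolynomial (Fin 2) ℝ) :
    moyal lam (c • f) g = c • moyal lam f g := by
  simp only [moyal_eq_finsum, map_smul, LinearMap.smul_apply, smul_finsum, smul_comm c]

theorem moyal_smul_right (lam c : ℝ) (f g : MvPolynomial (Fin 2) ℝ) :
    moyal lam f (c • g) = c • moyal lam f g := by
  simp only [moyal_eq_finsum, map_smul, smul_finsum, smul_comm c]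

/-- The Moyal product as a bilinear map. -/
noncomputable def moyalₗ (lam : ℝ) :
    MvPolynomial (Fin 2) ℝ →ₗ[ℝ] MvPolynomial (Fin 2) ℝ →ₗ[ℝ] MvPolynomial (Fin 2) ℝ :=
  LinearMap.mk₂ ℝ (moyal lam) (moyal_add_left lam) (moyal_smul_left lam)
    (moyal_add_right lam) (moyal_smul_right lam)

theorem moyalₗ_apply (lam : ℝ) (f g : MvPolynomial (Fin 2) ℝ) :
    moyalₗ lam f g = moyal lam f g := rfl

theorem moyal_zero_left (lam : ℝ) (g : MvPolynomial (Fin 2) ℝ) : moyal lam 0 g = 0 := by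
  rw [← moyalₗ_apply, map_zero, LinearMap.zero_apply]

theorem moyal_zero_right (lam : ℝ) (f : MvPolynomial (Fin 2) ℝ) : moyal lam f 0 = 0 :=
  map_zero (moyalₗ lam f)

theorem moyal_C_left (lam c : ℝ) (g : MvPolynomial (Fin 2) ℝ) : moyal lam (C c) g = c • g := by
  rw [moyal_eq_finsum, finsum_eq_single _ 0]
  · simp [poissonPow_zero, C_mul']
  · intro i hi
    obtain ⟨i, rfl⟩ := Nat.exists_eq_succ_of_ne_zero hi
    simp [poissonPow_C]

theorem moyal_one_left (lam : ℝ) (g : MvPolynomial (Fin 2) ℝ) : moyal lam 1 g = g := by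
  simpa using moyal_C_left lam 1 g

theorem pow_succ_div_factorial_mul (lam : ℝ) (i : ℕ) :
    lam ^ (i + 1) / ((i + 1).factorial : ℝ) * ((i + 1 : ℕ) : ℝ) =
      lam * (lam ^ i / (i.factorial : ℝ)) := by
  rw [Nat.factorial_succ]
  push_cast
  field_simp
  ring

theorem moyal_X_zero_mul (lam : ℝ) (f g : MvPolynomial (Fin 2) ℝ) :
    moyal lam (X 0 * f) g = X 0 * moyal lam f g + lam • moyal lam f (dP g) := by
  obtain ⟨N₁, h₁⟩ := moyal_eq_sum lam (X 0 * f) g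
  obtain ⟨N₂, h₂⟩ := moyal_eq_sum lam f g
  obtain ⟨N₃, h₃⟩ := moyal_eq_sum lam f (dP g)
  rw [h₁ (N₁ + N₂ + N₃ + 1) (by omega), h₂ (N₁ + N₂ + N₃ + 1) (by omega),
    h₃ (N₁ + N₂ + N₃) (by omega), Finset.sum_range_succ', Finset.sum_range_succ', mul_add,
    Finset.mul_sum, Finset.smul_sum, add_right_comm (∑ i ∈ _, _), ← Finset.sum_add_distrib]
  congr 1
  · refine Finset.sum_congr rfl fun i _ => ?_
    rw [poissonPow_X_zero_mul, smul_add, smul_smul, pow_succ_div_factorial_mul, mul_smul,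
      mul_smul_comm]
  · simp [poissonPow_zero, mul_assoc]

theorem moyal_X_one_mul (lam : ℝ) (f g : MvPolynomial (Fin 2) ℝ) :
    moyal lam (X 1 * f) g = X 1 * moyal lam f g - lam • moyal lam f (dX g) := by
  obtain ⟨N₁, h₁⟩ := moyal_eq_sum lam (X 1 * f) g
  obtain ⟨N₂, h₂⟩ := moyal_eq_sum lam f g
  obtain ⟨N₃, h₃⟩ := moyal_eq_sum lam f (dX g)
  rw [h₁ (N₁ + N₂ + N₃ + 1) (by omega), h₂ (N₁ + N₂ + N₃ + 1) (by omega),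
    h₃ (N₁ + N₂ + N₃) (by omega), Finset.sum_range_succ', Finset.sum_range_succ', mul_add,
    Finset.mul_sum, Finset.smul_sum, add_sub_right_comm, ← Finset.sum_sub_distrib]
  congr 1
  · refine Finset.sum_congr rfl fun i _ => ?_
    rw [poissonPow_X_one_mul, smul_sub, smul_smul, pow_succ_div_factorial_mul, mul_smul,
      mul_smul_comm]
  · simp [poissonPow_zero, mul_assoc]

theorem dX_moyal (lam : ℝ) (f g : MvPolynomial (Fin 2) ℝ) :
    dX (moyal lam f g) = moyal lam (dX f) g + moyal lam f (dX g) := by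
  induction f using MvPolynomial.induction_on generalizing g with
  | C a => simp [moyal_C_left, dX_smul, moyal_zero_left]
  | add f₁ f₂ h₁ h₂ => simp only [moyal_add_left, dX_add, h₁, h₂]; ring
  | mul_X f j hf =>
    fin_cases j
    · simp only [Fin.zero_eta, mul_comm f, moyal_X_zero_mul, dX_add, dX_mul, dX_C,
        dX_X_zero, one_mul, zero_mul, moyal_add_left, hf, dX_dP_comm, smul_eq_C_mul]
      ring
    · simp only [Fin.mk_one, mul_comm f, moyal_X_one_mul, dX_sub, dX_mul, dX_C,
        dX_X_one, zero_mul, zero_add, hf, smul_eq_C_mul]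
      ring

theorem dP_moyal (lam : ℝ) (f g : MvPolynomial (Fin 2) ℝ) :
    dP (moyal lam f g) = moyal lam (dP f) g + moyal lam f (dP g) := by
  induction f using MvPolynomial.induction_on generalizing g with
  | C a => simp [moyal_C_left, dP_smul, moyal_zero_left]
  | add f₁ f₂ h₁ h₂ => simp only [moyal_add_left, dP_add, h₁, h₂]; ring
  | mul_X f j hf =>
    fin_cases j
    · simp only [Fin.zero_eta, mul_comm f, moyal_X_zero_mul, dP_add, dP_mul, dP_C,
        dP_X_zero, zero_mul, zero_add, hf, smul_eq_C_mul]
      ring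
    · simp only [Fin.mk_one, mul_comm f, moyal_X_one_mul, dP_sub, dP_mul, dP_C,
        dP_X_one, one_mul, zero_mul, moyal_add_left, hf, dX_dP_comm, smul_eq_C_mul]
      ring

theorem moyal_one_right (lam : ℝ) (f : MvPolynomial (Fin 2) ℝ) : moyal lam f 1 = f := by
  induction f using MvPolynomial.induction_on with
  | C a => simp [moyal_C_left, smul_eq_C_mul]
  | add f₁ f₂ h₁ h₂ => rw [moyal_add_left, h₁, h₂]
  | mul_X f j hf =>
    fin_cases j
    · simp [mul_comm f, moyal_X_zero_mul, hf, dP, moyal_zero_right]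
    · simp [mul_comm f, moyal_X_one_mul, hf, dX, moyal_zero_right]

theorem moyal_X_zero_right (lam : ℝ) (f : MvPolynomial (Fin 2) ℝ) :
    moyal lam f (X 0) = X 0 * f - lam • dP f := by
  induction f using MvPolynomial.induction_on with
  | C a => simp [moyal_C_left, smul_eq_C_mul, mul_comm]
  | add f₁ f₂ h₁ h₂ => rw [moyal_add_left, h₁, h₂, dP_add, smul_add]; ring
  | mul_X f j hf =>
    fin_cases j
    · simp [mul_comm f, moyal_X_zero_mul, hf, dP_mul, moyal_zero_right, mul_sub]
    · simp only [Fin.mk_one, mul_comm f, moyal_X_one_mul, hf, dP_mul, moyal_one_right,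
        dX_X_zero, dP_X_one, smul_eq_C_mul]
      ring

theorem moyal_X_zero_left (lam : ℝ) (g : MvPolynomial (Fin 2) ℝ) :
    moyal lam (X 0) g = X 0 * g + lam • dP g := by
  simpa [moyal_one_left] using moyal_X_zero_mul lam 1 g

theorem dP_X_zero_pow (i : ℕ) : dP (X 0 ^ i) = 0 := by
  simp [dP, pderiv_X]

theorem dX_toMv (q : Polynomial ℝ) : dX (toMv q) = 0 := by
  simp [dX, toMv, Derivation.map_aeval, pderiv_X]

theorem dP_toMv (q : Polynomial ℝ) : dP (toMv q) = toMv (Polynomial.derivative q) := by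
  simp [dP, toMv, Derivation.map_aeval, pderiv_X]

theorem toMv_X_mul (q : Polynomial ℝ) : toMv (Polynomial.X * q) = X 1 * toMv q := by
  simp [toMv]

theorem toMv_induction {motive : MvPolynomial (Fin 2) ℝ → Prop} (hC : ∀ c, motive (C c))
    (hadd : ∀ f g, motive f → motive g → motive (f + g))
    (hX : ∀ q, motive (toMv q) → motive (X 1 * toMv q)) (q : Polynomial ℝ) :
    motive (toMv q) := by
  induction q using Polynomial.induction_on with
  | C a => simpa [toMv, algebraMap_eq] using hC a
  | add f g hf hg => simpa [toMv] using hadd _ _ hf hg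
  | monomial n a h =>
    rw [pow_succ, ← mul_assoc, mul_comm _ Polynomial.X, toMv_X_mul]
    exact hX _ h

theorem moyal_X_zero_assoc (lam : ℝ) (f g : MvPolynomial (Fin 2) ℝ) :
    moyal lam (moyal lam (X 0) f) g = moyal lam (X 0) (moyal lam f g) := by
  rw [moyal_X_zero_left, moyal_X_zero_left, moyal_add_left, moyal_smul_left, moyal_X_zero_mul,
    dP_moyal]
  module

theorem moyal_X_zero_pow_succ_left (lam : ℝ) (i : ℕ) (g : MvPolynomial (Fin 2) ℝ) :
    moyal lam (X 0 ^ (i + 1)) g = moyal lam (X 0) (moyal lam (X 0 ^ i) g) := by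
  rw [pow_succ', moyal_X_zero_mul, moyal_X_zero_left, dP_moyal, dP_X_zero_pow, moyal_zero_left,
    zero_add]

theorem moyal_X_zero_pow_assoc (lam : ℝ) (i : ℕ) (f g : MvPolynomial (Fin 2) ℝ) :
    moyal lam (moyal lam (X 0 ^ i) f) g = moyal lam (X 0 ^ i) (moyal lam f g) := by
  induction i with
  | zero => simp [moyal_one_left]
  | succ i ih => simp only [moyal_X_zero_pow_succ_left, moyal_X_zero_assoc, ih]

theorem moyal_X_one_left (lam : ℝ) (g : MvPolynomial (Fin 2) ℝ) :
    moyal lam (X 1) g = X 1 * g - lam • dX g := by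
  simpa [moyal_one_left] using moyal_X_one_mul lam 1 g

theorem moyal_X_one_assoc (lam : ℝ) (f g : MvPolynomial (Fin 2) ℝ) :
    moyal lam (moyal lam (X 1) f) g = moyal lam (X 1) (moyal lam f g) := by
  rw [moyal_X_one_left, moyal_X_one_left, ← moyalₗ_apply lam (_ - _), map_sub, LinearMap.sub_apply,
    moyalₗ_apply, moyalₗ_apply, moyal_smul_left, moyal_X_one_mul, dX_moyal]
  module

theorem moyal_X_one_mul_toMv (lam : ℝ) (q : Polynomial ℝ) (g : MvPolynomial (Fin 2) ℝ) :
    moyal lam (X 1 * toMv q) g = moyal lam (X 1) (moyal lam (toMv q) g) := by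
  rw [moyal_X_one_mul, moyal_X_one_left, dX_moyal, dX_toMv, moyal_zero_left,
    zero_add]

theorem moyal_toMv_assoc (lam : ℝ) (q : Polynomial ℝ) (f g : MvPolynomial (Fin 2) ℝ) :
    moyal lam (moyal lam (toMv q) f) g = moyal lam (toMv q) (moyal lam f g) := by
  refine toMv_induction
    (motive := fun u => moyal lam (moyal lam u f) g = moyal lam u (moyal lam f g))
    (fun c => ?_) (fun _ _ hf hg => ?_) (fun q ih => ?_) q
  · simp [moyal_C_left, moyal_smul_left]
  · simp only [moyal_add_left, hf, hg]
  · simp only [moyal_X_one_mul_toMv, moyal_X_one_assoc, ih]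

theorem moyal_toMv_toMv (lam : ℝ) (q r : Polynomial ℝ) :
    moyal lam (toMv q) (toMv r) = toMv (q * r) := by
  rw [show toMv (q * r) = toMv q * toMv r from map_mul _ _ _]
  refine toMv_induction (motive := fun u => moyal lam u (toMv r) = u * toMv r)
    (fun c => ?_) (fun _ _ hf hg => ?_) (fun q ih => ?_) q
  · rw [moyal_C_left, smul_eq_C_mul]
  · rw [moyal_add_left, hf, hg, add_mul]
  · rw [moyal_X_one_mul, ih, dX_toMv, moyal_zero_right, smul_zero, sub_zero, mul_assoc]

theorem moyal_X_zero_toMv (lam : ℝ) (q : Polynomial ℝ) :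
    moyal lam (X 0) (toMv q) =
      moyal lam (toMv q) (X 0) + (2 * lam) • toMv (Polynomial.derivative q) := by
  rw [moyal_X_zero_left, moyal_X_zero_right, dP_toMv]
  module

theorem moyal_X_zero_pow (lam : ℝ) (i : ℕ) : moyal lam (X 0) (X 0 ^ i) = X 0 ^ (i + 1) := by
  rw [moyal_X_zero_left, dP_X_zero_pow, smul_zero, add_zero, pow_succ']

/-- `Jl` as a subspace. -/
noncomputable def JlSubmodule (lam : ℝ) (n : ℕ) : Submodule ℝ (MvPolynomial (Fin 2) ℝ) :=
  LinearMap.range ((moyalₗ lam).flip (X 0 ^ n))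

theorem mem_JlSubmodule {lam : ℝ} {n : ℕ} {f : MvPolynomial (Fin 2) ℝ} :
    f ∈ JlSubmodule lam n ↔ f ∈ Jl lam n := by
  simp only [JlSubmodule, LinearMap.mem_range, LinearMap.flip_apply, moyalₗ_apply, Jl,
    Set.mem_ofPred_eq, eq_comm]

theorem moyal_toMv_mem_JlSubmodule {lam : ℝ} {n : ℕ} (q : Polynomial ℝ)
    {f : MvPolynomial (Fin 2) ℝ} (hf : f ∈ JlSubmodule lam n) :
    moyal lam (toMv q) f ∈ JlSubmodule lam n := by
  obtain ⟨g, rfl⟩ := hf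
  exact ⟨moyal lam (toMv q) g, moyal_toMv_assoc ..⟩

theorem moyal_X_zero_pow_mem_JlSubmodule (lam : ℝ) (n i : ℕ) (q : Polynomial ℝ) :
    moyal lam (X 0 ^ i) (moyal lam (toMv q) (X 0 ^ n)) -
      (2 * lam) ^ i • moyal lam (toMv ((⇑Polynomial.derivative)^[i] q)) (X 0 ^ n) ∈
      JlSubmodule lam (n + 1) := by
  induction i generalizing q with
  | zero => simp [moyal_one_left]
  | succ i ih =>
    have hX : moyal lam (X 0 ^ (i + 1)) (moyal lam (toMv q) (X 0 ^ n)) =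
        moyal lam (moyal lam (X 0 ^ i) (toMv q)) (X 0 ^ (n + 1)) +
          (2 * lam) • moyal lam (X 0 ^ i)
            (moyal lam (toMv (Polynomial.derivative q)) (X 0 ^ n)) := by
      have hpow : moyal lam (X 0 ^ i) (X 0) = X 0 ^ (i + 1) := by
        rw [moyal_X_zero_right, dP_X_zero_pow, smul_zero, sub_zero, pow_succ']
      rw [← hpow, moyal_X_zero_pow_assoc, ← moyal_X_zero_assoc, moyal_X_zero_toMv,
        moyal_add_left, moyal_smul_left, moyal_add_right, moyal_smul_right, moyal_toMv_assoc,
        moyal_X_zero_pow, moyal_X_zero_pow_assoc]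
    rw [hX, add_sub_assoc, Function.iterate_succ_apply, pow_succ' (2 * lam),
      mul_smul (2 * lam), ← smul_sub]
    exact Submodule.add_mem _ ⟨_, rfl⟩ (Submodule.smul_mem _ _ (ih _))

/-- module structure on V: for h = Σ_{i<n} h_i *_λ x^i with h_i ∈ ℝ[p] and
every k = 0,…,n−1, one has h *_λ (p^k *_λ x^{n−1}) ≡ g_k *_λ x^{n−1} mod J_l, where
g_k = Σ_{i=0}^{k} (2λ)^i h_i · (d^i p^k/dp^i). -/
theorem module_structure_on_V (lam : ℝ) (hlam : lam ≠ 0) (n : ℕ) (hn : 1 ≤ n)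
    (h : ℕ → Polynomial ℝ) :
    ∀ k ∈ Finset.range n,
      moyal lam (∑ i ∈ Finset.range n, moyal lam (toMv (h i)) (X 0 ^ i))
          (moyal lam (X 1 ^ k) (X 0 ^ (n - 1))) -
        moyal lam
          (toMv (∑ i ∈ Finset.range (k + 1),
            (2 * lam) ^ i • (h i * (⇑Polynomial.derivative)^[i] (Polynomial.X ^ k))))
          (X 0 ^ (n - 1)) ∈ Jl lam n := by
  intro k hk
  obtain ⟨n, rfl⟩ := Nat.exists_eq_add_of_le' hn
  rw [← mem_JlSubmodule, Nat.add_sub_cancel]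
  have hp : (X 1 ^ k : MvPolynomial (Fin 2) ℝ) = toMv (Polynomial.X ^ k) := by simp [toMv]
  have hg : toMv (∑ i ∈ Finset.range (k + 1),
      (2 * lam) ^ i • (h i * (⇑Polynomial.derivative)^[i] (Polynomial.X ^ k))) =
      ∑ i ∈ Finset.range (n + 1),
        (2 * lam) ^ i • toMv (h i * (⇑Polynomial.derivative)^[i] (Polynomial.X ^ k)) := by
    rw [Finset.sum_subset (Finset.range_subset_range.2 (Finset.mem_range.1 hk))]
    · simp only [toMv, map_sum, map_smul]
    · intro i _ hi
      rw [Polynomial.iterate_derivative_eq_zero, mul_zero, smul_zero]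
      rw [Polynomial.natDegree_X_pow]
      simpa using hi
  rw [hp, hg]
  simp only [← moyalₗ_apply, map_sum, LinearMap.sum_apply]
  simp only [moyalₗ_apply, moyal_smul_left]
  rw [← Finset.sum_sub_distrib]
  refine Submodule.sum_mem _ fun i _ => ?_
  rw [moyal_toMv_assoc, ← moyal_toMv_toMv lam, moyal_toMv_assoc, ← moyal_smul_right,
    ← moyalₗ_apply lam (toMv (h i)), ← moyalₗ_apply lam (toMv (h i)), ← map_sub]
  exact moyal_toMv_mem_JlSubmodule _ (moyal_X_zero_pow_mem_JlSubmodule ..)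
end

section
/- (Injectivity, from the proof of Theorem 3.5.) Let J_l := {g *_λ x^n : g ∈ ℝ[x,p]} and let h = Σ_{i=0}^{n−1} h_i *_λ x^i with h_i ∈ ℝ[p]. If h *_λ p^k *_λ x^{n−1} ∈ J_l for every k ∈ {0, 1, …, n−1}, then h_i = 0 for all i (equivalently, Σ_{i=0}^{k} (2λ)^i h_i · (d^i p^k/dp^i) = 0 for all k = 0,…,n−1 forces h₀ = … = h_{n−1} = 0). -/
/- The Moyal product on ℝ[x,p], where x = X 0 and p = X 1 in `MvPolynomial (Fin 2) ℝ`: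
   f *_λ g := Σ_{i=0}^∞ (λ^i/i!) Σ_{k=0}^i C(i,k) (−1)^k (∂_x^{i−k}∂_p^k f)·(∂_x^k ∂_p^{i−k} g).
   On polynomials only finitely many terms are nonzero, so the `finsum` below is faithful. -/

open MvPolynomial

namespace Moyal

/-- The operator `f ↦ X a * f + c ∂_b f`. -/
noncomputable def mulAddDeriv (a b : Fin 2) (c : ℝ) : Module.End ℝ (MvPolynomial (Fin 2) ℝ) :=
  LinearMap.mulLeft ℝ (X a) + c • (pderiv b).toLinearMap

lemma mulAddDeriv_apply (a b : Fin 2) (c : ℝ) (f : MvPolynomial (Fin 2) ℝ) :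
    mulAddDeriv a b c f = X a * f + c • pderiv b f := by
  simp [mulAddDeriv]

lemma mulAddDeriv_pow_apply {a b : Fin 2} (hab : a ≠ b) (c : ℝ) (m : ℕ)
    (f : MvPolynomial (Fin 2) ℝ) :
    (mulAddDeriv a b c ^ m) f =
      ∑ i ∈ Finset.range (m + 1),
        (c ^ i * m.choose i) • ((pderiv b)^[i] f * X a ^ (m - i)) := by
  have hcomm : Commute (c • ((pderiv b).toLinearMap : Module.End ℝ (MvPolynomial (Fin 2) ℝ)))
      (LinearMap.mulLeft ℝ (X a)) := by
    refine LinearMap.ext fun g => ?_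
    simp [pderiv_X_of_ne hab]
  rw [mulAddDeriv, add_comm, hcomm.add_pow, LinearMap.sum_apply]
  refine Finset.sum_congr rfl fun i _ => ?_
  rw [smul_pow, LinearMap.pow_mulLeft, ← Nat.cast_commute, ← nsmul_eq_mul, LinearMap.smul_apply,
    ← Nat.cast_smul_eq_nsmul ℝ, smul_mul_assoc, LinearMap.smul_apply, smul_smul,
    Module.End.mul_apply, ← LinearMap.pow_mulLeft, mul_comm (m.choose i : ℝ)]
  congr 1
  rw [← Module.End.mul_apply, ((?_ : Commute _ _).pow_pow _ _).eq, Module.End.mul_apply,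
    LinearMap.pow_mulLeft, LinearMap.mulLeft_apply, mul_comm, Module.End.pow_apply]
  · rfl
  · refine LinearMap.ext fun g => ?_
    simp [pderiv_X_of_ne hab]

lemma iterate_pderiv_X_pow (a : Fin 2) (m i : ℕ) :
    (pderiv a)^[i] (X a ^ m : MvPolynomial (Fin 2) ℝ) =
      (m.descFactorial i : ℝ) • X a ^ (m - i) := by
  induction i with
  | zero => simp
  | succ i ih =>
    rw [Function.iterate_succ_apply', ih, Derivation.map_smul, Derivation.leibniz_pow,
      pderiv_X_self, Nat.descFactorial_succ, Nat.cast_mul, mul_comm, mul_smul, smul_eq_mul,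
      mul_one, Nat.sub_sub, ← Nat.cast_smul_eq_nsmul ℝ (m - i), smul_comm]

lemma iterate_pderiv_X_pow_of_ne {a b : Fin 2} (hab : a ≠ b) (m : ℕ) {i : ℕ} (hi : i ≠ 0) :
    (pderiv b)^[i] (X a ^ m : MvPolynomial (Fin 2) ℝ) = 0 := by
  obtain ⟨i, rfl⟩ := Nat.exists_eq_succ_of_ne_zero hi
  rw [Function.iterate_succ_apply, Derivation.leibniz_pow, pderiv_X_of_ne hab, smul_zero,
    smul_zero, iterate_map_zero]

lemma finsum_exp_pderiv_X_pow (a b : Fin 2) (hab : a ≠ b) (c : ℝ) (m : ℕ)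
    (f : MvPolynomial (Fin 2) ℝ) :
    ∑ᶠ i : ℕ, (c ^ i / (i.factorial : ℝ)) • ((pderiv b)^[i] f * (pderiv a)^[i] (X a ^ m)) =
      (mulAddDeriv a b c ^ m) f := by
  rw [mulAddDeriv_pow_apply hab, finsum_eq_sum_of_support_subset (s := Finset.range (m + 1))]
  · refine Finset.sum_congr rfl fun i _ => ?_
    rw [iterate_pderiv_X_pow, mul_smul_comm, smul_smul, Nat.descFactorial_eq_factorial_mul_choose,
      Nat.cast_mul]
    congr 1
    have := i.factorial_ne_zero
    field_simp
  · intro i hi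
    by_contra hmi
    refine hi ?_
    have hmi : m < i := by simpa using hmi
    simp [iterate_pderiv_X_pow, Nat.descFactorial_of_lt hmi]

lemma moyal_X_zero_pow (lam : ℝ) (f : MvPolynomial (Fin 2) ℝ) (m : ℕ) :
    moyal lam f (X 0 ^ m) = (mulAddDeriv 0 1 (-lam) ^ m) f := by
  rw [← finsum_exp_pderiv_X_pow 0 1 (by decide), moyal]
  refine finsum_congr fun i => ?_
  rw [Finset.sum_eq_single i]
  · simp only [Nat.choose_self, Nat.cast_one, one_mul, Nat.sub_self, Function.iterate_zero, id_eq,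
      smul_smul]
    rw [neg_pow lam, div_mul_eq_mul_div, mul_comm (lam ^ i)]
    rfl
  · intro k hk hki
    have hk : k < i + 1 := Finset.mem_range.1 hk
    have h0 : dP^[i - k] (X 0 ^ m) = 0 := iterate_pderiv_X_pow_of_ne (by decide) m (by omega)
    have h1 : dX^[k] 0 = 0 := iterate_map_zero (pderiv (0 : Fin 2)) k
    rw [h0, h1, mul_zero, smul_zero]
  · simp

lemma moyal_X_one_pow (lam : ℝ) (f : MvPolynomial (Fin 2) ℝ) (m : ℕ) :
    moyal lam f (X 1 ^ m) = (mulAddDeriv 1 0 lam ^ m) f := by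
  rw [← finsum_exp_pderiv_X_pow 1 0 (by decide), moyal]
  refine finsum_congr fun i => ?_
  rw [Finset.sum_eq_single 0]
  · simp only [Nat.choose_zero_right, Nat.cast_one, one_mul, Nat.sub_zero, Function.iterate_zero,
      id_eq, pow_zero, one_smul]
    rfl
  · intro k hk hk0
    have h0 : dX^[k] (dP^[i - k] (X 1 ^ m)) = 0 := by
      have h1 := iterate_pderiv_X_pow 1 m (i - k)
      have h2 := iterate_pderiv_X_pow_of_ne (a := 1) (b := 0) (by decide) (m - (i - k)) hk0
      change (pderiv 0)^[k] ((pderiv 1)^[i - k] _) = 0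
      rw [h1, ← Derivation.coeFn_coe, ← Module.End.pow_apply, map_smul, Module.End.pow_apply,
        Derivation.coeFn_coe, h2, smul_zero]
    rw [h0, mul_zero, smul_zero]
  · simp

lemma pderiv_zero_toMv (q : Polynomial ℝ) : pderiv 0 (toMv q) = 0 := by
  rw [toMv, Derivation.map_aeval, pderiv_X_of_ne (by decide), smul_zero]

/-- If `(x + c ∂_p) g` does not depend on `x`, then `g = 0`. -/
lemma eq_zero_of_mulAddDeriv (c : ℝ) (g : MvPolynomial (Fin 2) ℝ)
    (hg : pderiv 0 (mulAddDeriv 0 1 c g) = 0) : g = 0 := by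
  by_contra hne
  obtain ⟨m, hm, hmax⟩ := g.support.exists_max_image (fun m => m 0) (support_nonempty.2 hne)
  have h1 := congrArg (coeff m) hg
  rw [coeff_pderiv, coeff_zero, mulAddDeriv_apply, coeff_add, coeff_smul, coeff_pderiv,
    add_comm m, coeff_X_mul] at h1
  have h2 : coeff (Finsupp.single 0 1 + m + Finsupp.single 1 1) g = 0 := by
    by_contra hc
    have := hmax _ (mem_support_iff.2 hc)
    simp at this
  rw [h2, zero_mul, smul_zero, add_zero] at h1
  refine (mul_ne_zero (mem_support_iff.1 hm) ?_) h1
  positivity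

lemma mulAddDeriv_zero_one_injective (c : ℝ) : Function.Injective (mulAddDeriv 0 1 c) :=
  (injective_iff_map_eq_zero _).2 fun g hg => eq_zero_of_mulAddDeriv c g (by rw [hg, map_zero])

lemma mulAddDeriv_commutator_pow (lam : ℝ) (i : ℕ) (f : MvPolynomial (Fin 2) ℝ) :
    mulAddDeriv 1 0 lam ((mulAddDeriv 0 1 (-lam) ^ (i + 1)) f) =
      (mulAddDeriv 0 1 (-lam) ^ (i + 1)) (mulAddDeriv 1 0 lam f) +
        (2 * lam * (i + 1)) • (mulAddDeriv 0 1 (-lam) ^ i) f := by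
  have hcomm (g) : mulAddDeriv 1 0 lam (mulAddDeriv 0 1 (-lam) g) =
      mulAddDeriv 0 1 (-lam) (mulAddDeriv 1 0 lam g) + (2 * lam) • g := by
    have hpd : pderiv 0 (pderiv 1 g) = pderiv 1 (pderiv 0 g) := by
      ext m
      simp only [coeff_pderiv, Finsupp.add_apply, Finsupp.single_apply, add_right_comm m]
      simp
      ring
    simp only [mulAddDeriv_apply, map_add, Derivation.leibniz, pderiv_X_self, hpd, smul_eq_mul,
      mul_one, MvPolynomial.smul_eq_C_mul, map_neg, map_mul, map_ofNat, pderiv_C, mul_zero,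
      add_zero]
    ring
  induction i with
  | zero => simpa using hcomm f
  | succ i ih =>
    rw [pow_succ', Module.End.mul_apply, hcomm, ih, map_add, map_smul, ← Module.End.mul_apply,
      ← pow_succ', add_assoc, ← Module.End.mul_apply (mulAddDeriv 0 1 (-lam)), ← pow_succ',
      ← add_smul]
    congr 2
    push_cast
    ring

/-- The normally ordered element `∑ i, h_i * x ^ i` attached to `∑ i, h_i X ^ i`. -/
noncomputable def ordered (lam : ℝ) :
    Polynomial (Polynomial ℝ) →ₗ[ℝ] MvPolynomial (Fin 2) ℝ :=
  Polynomial.lsum fun i =>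
    (mulAddDeriv 0 1 (-lam) ^ i) ∘ₗ (Polynomial.aeval (X 1)).toLinearMap

lemma ordered_monomial (lam : ℝ) (i : ℕ) (q : Polynomial ℝ) :
    ordered lam (Polynomial.monomial i q) = (mulAddDeriv 0 1 (-lam) ^ i) (toMv q) := by
  simp [ordered, toMv, Polynomial.lsum_apply, Polynomial.sum_monomial_index]

lemma ordered_X_mul (lam : ℝ) (F : Polynomial (Polynomial ℝ)) :
    ordered lam (Polynomial.X * F) = mulAddDeriv 0 1 (-lam) (ordered lam F) := by
  induction F using Polynomial.induction_on' with
  | add F G hF hG => rw [mul_add, map_add, hF, hG, map_add, map_add]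
  | monomial i q =>
    rw [Polynomial.X_mul_monomial, ordered_monomial, ordered_monomial, pow_succ',
      Module.End.mul_apply]

/-- The operator `F ↦ p F + 2 λ ∂_X F` corresponding to right multiplication by `p`. -/
noncomputable def rightMulP (lam : ℝ) : Module.End ℝ (Polynomial (Polynomial ℝ)) :=
  (2 * lam) • Polynomial.derivative.restrictScalars ℝ +
    LinearMap.mulLeft ℝ (Polynomial.C Polynomial.X)

lemma ordered_rightMulP (lam : ℝ) (F : Polynomial (Polynomial ℝ)) :
    ordered lam (rightMulP lam F) = mulAddDeriv 1 0 lam (ordered lam F) := by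
  induction F using Polynomial.induction_on' with
  | add F G hF hG => rw [map_add, map_add, hF, hG, map_add, map_add]
  | monomial i q =>
    have hq : mulAddDeriv 1 0 lam (toMv q) = toMv (Polynomial.X * q) := by
      simp [mulAddDeriv_apply, toMv]
    simp only [rightMulP, LinearMap.add_apply, LinearMap.smul_apply,
      LinearMap.restrictScalars_apply, LinearMap.mulLeft_apply, Polynomial.C_mul_monomial,
      Polynomial.derivative_monomial, map_add, map_smul, ordered_monomial]
    cases i with
    | zero =>
      simp only [pow_zero, Module.End.one_apply, hq]
      simp [toMv]
    | succ i =>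
      rw [mulAddDeriv_commutator_pow, hq, add_comm]
      congr 1
      have : toMv (q * ((i + 1 : ℕ) : Polynomial ℝ)) = ((i : ℝ) + 1) • toMv q := by
        simp [toMv, MvPolynomial.smul_eq_C_mul, mul_comm]
      rw [this, map_smul, smul_smul, Nat.add_sub_cancel]

lemma ordered_rightMulP_pow (lam : ℝ) (k : ℕ) (F : Polynomial (Polynomial ℝ)) :
    ordered lam ((rightMulP lam ^ k) F) = (mulAddDeriv 1 0 lam ^ k) (ordered lam F) := by
  induction k with
  | zero => simp
  | succ k ih =>
    rw [pow_succ', Module.End.mul_apply, ordered_rightMulP, ih, pow_succ', Module.End.mul_apply]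

lemma coeff_zero_eq_zero_of_ordered_mem_range (lam : ℝ) (F : Polynomial (Polynomial ℝ))
    (hF : ordered lam F ∈ LinearMap.range (mulAddDeriv 0 1 (-lam))) : F.coeff 0 = 0 := by
  obtain ⟨g, hg⟩ := hF
  rw [← Polynomial.X_mul_divX_add F, map_add, ordered_X_mul, ← Polynomial.monomial_zero_left,
    ordered_monomial, pow_zero, Module.End.one_apply, ← sub_eq_iff_eq_add', ← map_sub] at hg
  have h0 := eq_zero_of_mulAddDeriv (-lam) _ (by rw [hg, pderiv_zero_toMv])
  rw [h0, map_zero] at hg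
  refine (map_eq_zero_iff (Polynomial.aeval (R := ℝ) (X 1 : MvPolynomial (Fin 2) ℝ)) ?_).1 hg.symm
  exact transcendental_iff_injective.1 (transcendental_X ℝ 1)

lemma coeff_zero_rightMulP_pow (lam : ℝ) (k : ℕ) (F : Polynomial (Polynomial ℝ)) :
    ((rightMulP lam ^ k) F).coeff 0 =
      ∑ i ∈ Finset.range (k + 1),
        (2 * lam) ^ i •
          (F.coeff i * (⇑Polynomial.derivative)^[i] ((Polynomial.X : Polynomial ℝ) ^ k)) := by
  have hcomm : Commute
      ((2 * lam) • (Polynomial.derivative.restrictScalars ℝ :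
        Module.End ℝ (Polynomial (Polynomial ℝ))))
      (LinearMap.mulLeft ℝ (Polynomial.C Polynomial.X)) := by
    refine LinearMap.ext fun G => ?_
    simp
  rw [rightMulP, hcomm.add_pow, LinearMap.sum_apply, Polynomial.finsetSum_coeff]
  refine Finset.sum_congr rfl fun i _ => ?_
  have hpow (G : Polynomial (Polynomial ℝ)) :
      ((Polynomial.derivative.restrictScalars ℝ :
        Module.End ℝ (Polynomial (Polynomial ℝ))) ^ i) G = Polynomial.derivative^[i] G := by
    rw [Module.End.pow_apply]
    rfl
  rw [smul_pow, LinearMap.pow_mulLeft, ← Nat.cast_commute, ← nsmul_eq_mul, LinearMap.smul_apply,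
    smul_mul_assoc, LinearMap.smul_apply, Module.End.mul_apply, hpow, LinearMap.mulLeft_apply,
    ← Polynomial.C_pow, Polynomial.iterate_derivative_C_mul, Polynomial.coeff_smul,
    Polynomial.coeff_smul, Polynomial.coeff_C_mul, Polynomial.coeff_iterate_derivative,
    Polynomial.iterate_derivative_X_pow_eq_smul, zero_add, Nat.descFactorial_self,
    Nat.descFactorial_eq_factorial_mul_choose]
  simp only [Algebra.smul_def, Nat.cast_mul, eq_natCast]
  push_cast
  ring

lemma eq_zero_of_sum_iterate_derivative (lam : ℝ) (hlam : lam ≠ 0) (n : ℕ)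
    (h : ℕ → Polynomial ℝ)
    (hsum : ∀ k ∈ Finset.range n, ∑ i ∈ Finset.range (k + 1),
      (2 * lam) ^ i •
        (h i * (⇑Polynomial.derivative)^[i] ((Polynomial.X : Polynomial ℝ) ^ k)) = 0) :
    ∀ i ∈ Finset.range n, h i = 0 := by
  intro i
  induction i using Nat.strong_induction_on with
  | _ i ih =>
    intro hi
    have hin := Finset.mem_range.1 hi
    have hk := hsum i hi
    rw [Finset.sum_range_succ, Finset.sum_eq_zero, zero_add,
      Polynomial.iterate_derivative_X_pow_eq_smul, Nat.descFactorial_self, Nat.sub_self, pow_zero,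
      smul_eq_zero_iff_right (pow_ne_zero _ (mul_ne_zero two_ne_zero hlam)),
      mul_eq_zero] at hk
    · refine hk.resolve_right ?_
      simp [Nat.factorial_ne_zero]
    · intro j hj
      have hj := Finset.mem_range.1 hj
      rw [ih j hj (Finset.mem_range.2 (by omega)), zero_mul, smul_zero]

end Moyal

/-- injectivity: for h = Σ_{i<n} h_i *_λ x^i with h_i ∈ ℝ[p], if
h *_λ p^k *_λ x^{n−1} ∈ J_l for every k = 0,…,n−1, then all h_i vanish; equivalently,
Σ_{i=0}^{k} (2λ)^i h_i · (d^i p^k/dp^i) = 0 for all k = 0,…,n−1 forces h₀ = … = h_{n−1} = 0. -/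
theorem injectivity (lam : ℝ) (hlam : lam ≠ 0) (n : ℕ) (hn : 1 ≤ n)
    (h : ℕ → Polynomial ℝ) :
    ((∀ k ∈ Finset.range n,
        moyal lam
          (moyal lam (∑ i ∈ Finset.range n, moyal lam (toMv (h i)) (X 0 ^ i)) (X 1 ^ k))
          (X 0 ^ (n - 1)) ∈ Jl lam n) →
      ∀ i ∈ Finset.range n, h i = 0) ∧
    ((∀ k ∈ Finset.range n,
        ∑ i ∈ Finset.range (k + 1),
          (2 * lam) ^ i • (h i * (⇑Polynomial.derivative)^[i] ((Polynomial.X : Polynomial ℝ) ^ k)) = 0) →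
      ∀ i ∈ Finset.range n, h i = 0) := by
  refine ⟨fun hJ => ?_, Moyal.eq_zero_of_sum_iterate_derivative lam hlam n h⟩
  refine Moyal.eq_zero_of_sum_iterate_derivative lam hlam n h fun k hk => ?_
  set F : Polynomial (Polynomial ℝ) := ∑ i ∈ Finset.range n, Polynomial.monomial i (h i) with hF
  have hcoeff (i : ℕ) (hi : i < n) : F.coeff i = h i := by
    simp [hF, Polynomial.finsetSum_coeff, Polynomial.coeff_monomial, hi]
  have hord : ∑ i ∈ Finset.range n, moyal lam (toMv (h i)) (X 0 ^ i) = Moyal.ordered lam F := by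
    simp only [hF, map_sum, Moyal.ordered_monomial, Moyal.moyal_X_zero_pow]
  obtain ⟨g, hg⟩ := hJ k hk
  obtain ⟨m, rfl⟩ := Nat.exists_eq_add_of_le' hn
  rw [hord, Moyal.moyal_X_one_pow, Moyal.moyal_X_zero_pow, Moyal.moyal_X_zero_pow,
    ← Moyal.ordered_rightMulP_pow, Nat.add_sub_cancel, pow_succ, Module.End.mul_apply,
    Module.End.pow_apply _ m, Module.End.pow_apply _ m] at hg
  have hrange := (Moyal.mulAddDeriv_zero_one_injective (-lam)).iterate m hg
  have hzero := Moyal.coeff_zero_eq_zero_of_ordered_mem_range lam _ ⟨g, hrange.symm⟩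
  rw [Moyal.coeff_zero_rightMulP_pow] at hzero
  rw [← hzero]
  refine Finset.sum_congr rfl fun i hi => ?_
  rw [Finset.mem_range] at hi hk
  rw [hcoeff i (by omega)]
end
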